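/- arXiv:1411.7815 — 2 statements merged into one kernel-verified Lean document; each statement's English description precedes it below -/
import Mathlib

section
/- For every real number b with 0 < b < 1 there exists an entire function f such that for every a ∈ ℂ\{0} the set {z ↦ f(z + e^{n^b} a) : n = 1, 2, …} is dense in H(ℂ); that is, ⋂_{a ∈ ℂ\{0}} HC({T_{e^{n^b} a}}) ≠ ∅. -/
open Complex Filter Topology Set Polynomial

noncomputable section

/-- The space `H(ℂ)` of entire functions, viewed as the subspace of continuous maps
`ℂ → ℂ` (with the compact-open topology) consisting of differentiable functions. -/
abbrev Hc := {f : C(ℂ, ℂ) // Differentiable ℂ (f : ℂ → ℂ)}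

/-- Translation of an entire function by `w` : `z ↦ f (z + w)`. -/
def translateH (f : Hc) (w : ℂ) : Hc :=
  ⟨⟨fun z => f.1 (z + w), f.1.continuous.comp (continuous_id.add continuous_const)⟩,
   f.2.comp (differentiable_id.add_const w)⟩

/-- `HC lam a` : the set of entire functions `f` such that `{z ↦ f (z + lam n * a) : n}`
is dense in `H(ℂ)`. -/
def HC (lam : ℕ → ℂ) (a : ℂ) : Set Hc :=
  {f | Dense (Set.range fun n : ℕ => translateH f (lam n * a))}

theorem isPreconnected_compl_union_closedBall {E : Set ℂ} {c : ℂ} {r r' : ℝ} (hr : 0 ≤ r)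
    (hr' : r < r') (hE : Disjoint E (Metric.closedBall c r'))
    (h : IsPreconnected (E ∪ {c})ᶜ) : IsPreconnected (E ∪ Metric.closedBall c r)ᶜ := by
  have h0 : 0 < r' := hr.trans_lt hr'
  obtain ⟨k, hk⟩ : ∃ k, k = 1 - r / r' := ⟨_, rfl⟩
  have hkr : k * r' = r' - r := by rw [hk]; field_simp
  have hk0 : 0 < k := by rw [hk, sub_pos, div_lt_one h0]; exact hr'
  set φ : ℂ → ℂ := fun z => c + ((max 1 (r / ‖z - c‖ + k) : ℝ) : ℂ) * (z - c) with hφ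
  have hout : ∀ z, r' ≤ ‖z - c‖ → φ z = z := by
    intro z hz
    have : r / ‖z - c‖ + k ≤ 1 := by
      have : r / ‖z - c‖ ≤ r / r' := div_le_div_of_nonneg_left hr h0 hz
      linarith
    simp [hφ, max_eq_left this]
  have hin : ∀ z, z ≠ c → ‖z - c‖ < r' → φ z = c + ((r / ‖z - c‖ + k : ℝ) : ℂ) * (z - c) := by
    intro z hzc hz
    have hp : 0 < ‖z - c‖ := norm_pos_iff.2 (sub_ne_zero.2 hzc)
    have : 1 ≤ r / ‖z - c‖ + k := by
      have : r / r' ≤ r / ‖z - c‖ := div_le_div_of_nonneg_left hr hp hz.le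
      linarith
    simp only [hφ, max_eq_right this]
  have hin' : ∀ z, z ≠ c → ‖z - c‖ < r' → ‖φ z - c‖ = r + k * ‖z - c‖ := by
    intro z hzc hz
    have hp : 0 < ‖z - c‖ := norm_pos_iff.2 (sub_ne_zero.2 hzc)
    rw [hin z hzc hz, add_sub_cancel_left, norm_mul, norm_real, Real.norm_of_nonneg (by positivity)]
    field_simp
  have hcont : ContinuousOn φ (E ∪ {c})ᶜ := by
    refine continuousOn_const.add (ContinuousOn.mul ?_ (by fun_prop))
    refine continuous_ofReal.comp_continuousOn (ContinuousOn.sup continuousOn_const ?_)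
    refine (continuousOn_const.div (by fun_prop) ?_).add continuousOn_const
    intro z hz h
    exact hz (Or.inr (sub_eq_zero.1 (norm_eq_zero.1 h)))
  have himg : φ '' (E ∪ {c})ᶜ = (E ∪ Metric.closedBall c r)ᶜ := by
    have hE' : ∀ z, ‖z - c‖ ≤ r' → z ∉ E := fun z hz hzE =>
      Set.disjoint_left.1 hE hzE (by simpa [dist_eq_norm] using hz)
    ext y
    simp only [Set.mem_image, Set.mem_compl_iff, Set.mem_union, Set.mem_singleton_iff, not_or,
      Metric.mem_closedBall, dist_eq_norm, not_le]
    constructor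
    · rintro ⟨z, ⟨hzE, hzc⟩, rfl⟩
      rcases le_or_gt r' ‖z - c‖ with hz | hz
      · rw [hout z hz]
        exact ⟨hzE, hr'.trans_le hz⟩
      · have hp : 0 < ‖z - c‖ := norm_pos_iff.2 (sub_ne_zero.2 hzc)
        have h1 := hin' z hzc hz
        refine ⟨hE' _ ?_, ?_⟩
        · rw [h1]; nlinarith
        · rw [h1]; nlinarith
    · rintro ⟨hyE, hy⟩
      rcases le_or_gt r' ‖y - c‖ with hz | hz
      · refine ⟨y, ⟨hyE, ?_⟩, hout y hz⟩
        rintro rfl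
        simp at hz; linarith
      · have hd : 0 < ‖y - c‖ := hr.trans_lt hy
        set d := ‖y - c‖ with hdd
        have hyc : y - c ≠ 0 := norm_pos_iff.1 hd
        have hs : 0 < (d - r) / (k * d) := div_pos (by linarith) (by positivity)
        have hzc : ‖(c + (((d - r) / (k * d) : ℝ) : ℂ) * (y - c)) - c‖ = (d - r) / k := by
          rw [add_sub_cancel_left, norm_mul, norm_real, Real.norm_of_nonneg hs.le, ← hdd]
          field_simp
        have hlt : (d - r) / k < r' := by rw [div_lt_iff₀ hk0]; nlinarith
        have hne : c + (((d - r) / (k * d) : ℝ) : ℂ) * (y - c) ≠ c := by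
          intro h
          rw [h, sub_self, norm_zero] at hzc
          have : 0 < (d - r) / k := div_pos (by linarith) hk0
          linarith
        refine ⟨_, ⟨hE' _ (hzc.le.trans hlt.le), hne⟩, ?_⟩
        rw [hin _ hne (hzc.trans_lt hlt), hzc, add_sub_cancel_left, ← mul_assoc, ← ofReal_mul]
        have : (r / ((d - r) / k) + k) * ((d - r) / (k * d)) = 1 := by
          have : d - r ≠ 0 := by linarith
          field_simp
          ring
        rw [this]; simp
  rw [← himg]
  exact h.image _ hcont

theorem isPreconnected_compl_iUnion_closedBall {ι : Type*} [Finite ι] {c : ι → ℂ} {r : ι → ℝ}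
    (hr : ∀ i, 0 ≤ r i) (hd : ∀ i j, i ≠ j → r i + r j < dist (c i) (c j)) :
    IsPreconnected (⋃ i, Metric.closedBall (c i) (r i))ᶜ := by
  classical
  have := Fintype.ofFinite ι
  have key : ∀ s : Finset ι, IsPreconnected
      ((⋃ i ∈ s, Metric.closedBall (c i) (r i)) ∪ ⋃ i ∈ sᶜ, {c i})ᶜ := by
    intro s
    induction s using Finset.induction_on with
    | empty =>
      refine (Set.Countable.isConnected_compl_of_one_lt_rank ?_ ?_).isPreconnected
      · simp
      · simpa using Set.countable_iUnion fun i => Set.countable_singleton (c i)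
    | insert k s hk ih =>
      have hset : ((⋃ i ∈ insert k s, Metric.closedBall (c i) (r i)) ∪ ⋃ i ∈ (insert k s)ᶜ, {c i})
          = ((⋃ i ∈ s, Metric.closedBall (c i) (r i)) ∪ ⋃ i ∈ (insert k s)ᶜ, {c i}) ∪
            Metric.closedBall (c k) (r k) := by
        rw [Finset.set_biUnion_insert]
        ac_rfl
      have hset' : ((⋃ i ∈ s, Metric.closedBall (c i) (r i)) ∪ ⋃ i ∈ sᶜ, {c i})
          = ((⋃ i ∈ s, Metric.closedBall (c i) (r i)) ∪ ⋃ i ∈ (insert k s)ᶜ, {c i}) ∪ {c k} := by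
        have : sᶜ = insert k (insert k s)ᶜ := by
          ext j; by_cases h : j = k <;> simp [h, hk]
        rw [this, Finset.set_biUnion_insert]
        ac_rfl
      rw [hset]
      rw [hset'] at ih
      obtain ⟨e, he0, he⟩ : ∃ e > 0, ∀ i, i ≠ k → r i + r k + e < dist (c i) (c k) := by
        have : ∀ᶠ e in 𝓝[>] (0 : ℝ), ∀ i, i ≠ k → r i + r k + e < dist (c i) (c k) := by
          refine Filter.eventually_all.2 fun i => ?_
          by_cases h : i = k
          · simp [h]
          have h1 : Tendsto (fun e : ℝ => r i + r k + e) (𝓝[>] 0) (𝓝 (r i + r k + 0)) :=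
            ((continuous_const.add continuous_id).tendsto _).mono_left nhdsWithin_le_nhds
          filter_upwards [h1.eventually_lt_const (by simpa using hd i k h)] with e he _ using he
        obtain ⟨e, h1, h2⟩ := (this.and self_mem_nhdsWithin).exists
        exact ⟨e, h2, h1⟩
      refine isPreconnected_compl_union_closedBall (hr k) (lt_add_of_pos_right _ he0) ?_ ih
      rw [Set.disjoint_left]
      intro z hz hzk
      rw [Metric.mem_closedBall] at hzk
      have aux : ∀ i, i ≠ k → ¬ dist z (c i) ≤ r i := by
        intro i hi hzi
        have := he i hi
        have := dist_triangle_left (c i) (c k) z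
        linarith
      simp only [Set.mem_union, Set.mem_iUnion, Metric.mem_closedBall, Set.mem_singleton_iff,
        Finset.mem_compl, Finset.mem_insert, not_or, exists_prop] at hz
      rcases hz with ⟨i, hi, hzi⟩ | ⟨i, ⟨hi, _⟩, rfl⟩
      · exact aux i (fun h => hk (h ▸ hi)) hzi
      · exact aux i hi (by simpa using hr i)
  simpa using key Finset.univ

/-- The uniform closure of the polynomials in `C(K, ℂ)`. -/
def polynomialClosure (K : Set ℂ) [CompactSpace K] : Subalgebra ℂ C(K, ℂ) :=
  Algebra.elemental ℂ ((ContinuousMap.id ℂ).restrict K)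

theorem aeval_restrict_id_apply {K : Set ℂ} (p : ℂ[X]) (z : K) :
    aeval ((ContinuousMap.id ℂ).restrict K) p z = p.eval (z : ℂ) := by
  induction p using Polynomial.induction_on' with
  | add p q hp hq => simp [hp, hq]
  | monomial n a => simp [aeval_monomial]

theorem exists_polynomial_of_mem_polynomialClosure {K : Set ℂ} [CompactSpace K] {f : C(K, ℂ)}
    (hf : f ∈ polynomialClosure K) {ε : ℝ} (hε : 0 < ε) :
    ∃ p : ℂ[X], ∀ z : K, ‖p.eval (z : ℂ) - f z‖ < ε := by
  have h : f ∈ closure ((Algebra.adjoin ℂ {(ContinuousMap.id ℂ).restrict K} :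
    Subalgebra ℂ C(K, ℂ)) : Set C(K, ℂ)) := hf
  obtain ⟨g, hg, hfg⟩ := Metric.mem_closure_iff.1 h ε hε
  rw [SetLike.mem_coe, Algebra.adjoin_singleton_eq_range_aeval] at hg
  obtain ⟨p, rfl⟩ := hg
  refine ⟨p, fun z => ?_⟩
  rw [dist_comm] at hfg
  have hz := (ContinuousMap.dist_apply_le_dist z).trans_lt hfg
  rw [dist_eq_norm] at hz
  rwa [← aeval_restrict_id_apply]

theorem id_mem_polynomialClosure (K : Set ℂ) [CompactSpace K] :
    (ContinuousMap.id ℂ).restrict K ∈ polynomialClosure K :=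
  Algebra.elemental.self_mem _ _

theorem isClosed_polynomialClosure (K : Set ℂ) [CompactSpace K] :
    IsClosed (polynomialClosure K : Set C(K, ℂ)) :=
  Algebra.elemental.isClosed _ _

theorem restrict_mem_polynomialClosure (K : Set ℂ) [CompactSpace K] (f : C(ℂ, ℂ))
    (hf : Differentiable ℂ f) : f.restrict K ∈ polynomialClosure K := by
  obtain ⟨R, hR⟩ := (isCompact_iff_compactSpace.2 ‹CompactSpace K›).isBounded.subset_ball (0 : ℂ)
  let r : NNReal := ⟨max R 0, le_max_right _ _⟩
  have hps := hf.hasFPowerSeriesOnBall 0 (R := r + 1) (by positivity)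
  have ht := hps.tendstoUniformlyOn (r' := r) (by simp)
  let F : ℕ → C(K, ℂ) := fun n => ∑ i ∈ Finset.range n,
    (cauchyPowerSeries f 0 (r + 1 : NNReal)).coeff i • ((ContinuousMap.id ℂ).restrict K) ^ i
  have hF : ∀ n, F n ∈ polynomialClosure K := fun n =>
    Subalgebra.sum_mem _ fun i _ => Subalgebra.smul_mem _
      (Subalgebra.pow_mem _ (id_mem_polynomialClosure K) i) _
  have hlim : Tendsto F atTop (𝓝 (f.restrict K)) := by
    rw [ContinuousMap.tendsto_iff_tendstoUniformly, Metric.tendstoUniformly_iff]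
    intro ε hε
    filter_upwards [Metric.tendstoUniformlyOn_iff.1 ht ε hε] with n hn z
    have := hn z ((Metric.mem_ball.1 (hR z.2)).trans_le (le_max_left _ _))
    simp only [zero_add] at this
    have hFz : F n z = (cauchyPowerSeries f 0 (r + 1 : NNReal)).partialSum n z := by
      rw [ContinuousMap.sum_apply, FormalMultilinearSeries.partialSum]
      refine Finset.sum_congr rfl fun i _ => ?_
      rw [FormalMultilinearSeries.apply_eq_pow_smul_coeff]
      simp [mul_comm]
    rw [hFz]
    exact this
  exact (isClosed_polynomialClosure K).mem_of_tendsto hlim (Eventually.of_forall hF)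

theorem spectrum_id_polynomialClosure (K : Set ℂ) [CompactSpace K] (hK : IsPreconnected Kᶜ) :
    spectrum ℂ (⟨_, id_mem_polynomialClosure K⟩ : polynomialClosure K) = K := by
  have h : spectrum ℂ ((ContinuousMap.id ℂ).restrict K : C(K, ℂ)) = K := by
    rw [ContinuousMap.spectrum_eq_range]
    ext; simp
  have : IsClosed ((polynomialClosure K : Subalgebra ℂ C(K, ℂ)) : Set C(K, ℂ)) :=
    isClosed_polynomialClosure K
  rw [Subalgebra.spectrum_eq_of_isPreconnected_compl (polynomialClosure K)
    ⟨_, id_mem_polynomialClosure K⟩ (by rwa [h]), h]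

theorem exists_mul_eval_eq_one {K : Set ℂ} [CompactSpace K] [Nonempty K]
    (hK : IsPreconnected Kᶜ) (q : ℂ[X]) (hq : ∀ z ∈ K, q.eval z ≠ 0) :
    ∃ u ∈ polynomialClosure K, ∀ z : K, u z * q.eval (z : ℂ) = 1 := by
  set x : polynomialClosure K := ⟨_, id_mem_polynomialClosure K⟩ with hx
  have hs := spectrum_id_polynomialClosure K hK
  have h0 : (0 : ℂ) ∉ spectrum ℂ (aeval x q) := by
    rw [spectrum.map_polynomial_aeval_of_nonempty _ _ (by rw [hs]; exact Set.nonempty_coe_sort.1 ‹_›),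
      hs]
    rintro ⟨z, hz, h⟩
    exact hq z hz h
  obtain ⟨u, hu⟩ := (spectrum.zero_notMem_iff ℂ).1 h0
  refine ⟨(↑u⁻¹ : polynomialClosure K), Subtype.property _, fun z => ?_⟩
  have h1 : (↑u⁻¹ : polynomialClosure K) * aeval x q = 1 := by rw [← hu]; simp
  have h2 := congrArg (fun f : polynomialClosure K => (f : C(K, ℂ)) z) h1
  have h3 : ((aeval x q : polynomialClosure K) : C(K, ℂ)) = aeval ((ContinuousMap.id ℂ).restrict K) q :=
    (Polynomial.aeval_algHom_apply (polynomialClosure K).val x q).symm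
  simp only [MulMemClass.coe_mul, OneMemClass.coe_one, ContinuousMap.mul_apply,
    ContinuousMap.one_apply, h3, aeval_restrict_id_apply] at h2
  exact h2

theorem norm_inv_one_sub_pow_sub_one_le {w : ℂ} {s : ℝ} {m : ℕ} (hm : s ^ m < 1) (hw : ‖w‖ ≤ s) :
    ‖(1 - w ^ m)⁻¹ - 1‖ ≤ s ^ m / (1 - s ^ m) := by
  have h1 : ‖w ^ m‖ ≤ s ^ m := by rw [norm_pow]; gcongr
  have h2 : 1 - s ^ m ≤ ‖1 - w ^ m‖ := by
    have := norm_sub_norm_le (1 : ℂ) (w ^ m)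
    rw [norm_one] at this; linarith
  have h3 : 1 - w ^ m ≠ 0 := norm_pos_iff.1 (by linarith)
  have : (1 - w ^ m)⁻¹ - 1 = w ^ m / (1 - w ^ m) := by field_simp; ring
  rw [this, norm_div]
  have : 0 < 1 - s ^ m := by linarith
  have := (norm_nonneg _).trans h1
  gcongr

theorem norm_inv_one_sub_pow_le {w : ℂ} {s : ℝ} {m : ℕ} (hs : 0 < s) (hm : s ^ m < 1)
    (hw : 1 ≤ s * ‖w‖) : ‖(1 - w ^ m)⁻¹‖ ≤ s ^ m / (1 - s ^ m) := by
  have h1 : 1 ≤ s ^ m * ‖w ^ m‖ := by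
    rw [norm_pow, ← mul_pow]; exact one_le_pow₀ hw
  have h2 : ‖w ^ m‖ - 1 ≤ ‖1 - w ^ m‖ := by
    have := norm_sub_norm_le (w ^ m) (1 : ℂ)
    rwa [norm_one, norm_sub_rev] at this
  have h0 : 0 < s ^ m := by positivity
  have h3 : 1 - s ^ m ≤ s ^ m * ‖1 - w ^ m‖ := by nlinarith
  have h4 : 0 < ‖1 - w ^ m‖ := by
    by_contra h
    have : ‖1 - w ^ m‖ = 0 := le_antisymm (not_lt.1 h) (norm_nonneg _)
    rw [this] at h3; linarith
  rw [norm_inv, le_div_iff₀ (by linarith), inv_mul_le_iff₀ h4]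
  linarith

theorem mem_polynomialClosure_of_eq_indicator {K : Set ℂ} [CompactSpace K] (hK : IsPreconnected Kᶜ)
    {c : ℂ} {ρ s : ℝ} (hρ : 0 < ρ) (hs0 : 0 < s) (hs1 : s < 1)
    (h : ∀ z ∈ K, ‖z - c‖ ≤ s * ρ ∨ ρ ≤ s * ‖z - c‖) {χ : C(K, ℂ)}
    (h1 : ∀ z : K, ‖(z : ℂ) - c‖ ≤ s * ρ → χ z = 1)
    (h2 : ∀ z : K, ρ ≤ s * ‖(z : ℂ) - c‖ → χ z = 0) : χ ∈ polynomialClosure K := by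
  rcases isEmpty_or_nonempty K with hE | hE
  · rw [show χ = 0 from ContinuousMap.ext fun z => hE.elim z]
    exact Subalgebra.zero_mem _
  have hlt : ∀ m : ℕ, s ^ (m + 1) < 1 := fun m => pow_lt_one₀ hs0.le hs1 (by simp)
  have hw : ∀ z ∈ K, ‖(z - c) / ρ‖ ≤ s ∨ 1 ≤ s * ‖(z - c) / ρ‖ := by
    intro z hz
    rw [norm_div, norm_real, Real.norm_of_nonneg hρ.le, div_le_iff₀ hρ, mul_div_assoc',
      le_div_iff₀ hρ, one_mul]
    exact h z hz
  have hne : ∀ (m : ℕ), ∀ z ∈ K, 1 - ((z - c) / ρ) ^ (m + 1) ≠ 0 := by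
    intro m z hz h0
    have h3 : ‖(z - c) / ρ‖ ^ (m + 1) = 1 := by
      rw [← norm_pow, ← sub_eq_zero.1 h0, norm_one]
    have h4 : ‖(z - c) / ρ‖ = 1 := (pow_eq_one_iff_of_nonneg (norm_nonneg _) (by simp)).1 h3
    have := hw z hz
    rw [h4] at this
    rcases this with h | h <;> linarith
  have hex : ∀ m : ℕ, ∃ u ∈ polynomialClosure K, ∀ z : K,
      u z = (1 - (((z : ℂ) - c) / ρ) ^ (m + 1))⁻¹ := by
    intro m
    obtain ⟨u, hu, hu'⟩ := exists_mul_eval_eq_one hK (1 - ((X - C c) * C ((ρ : ℂ)⁻¹)) ^ (m + 1))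
      (fun z hz => by simpa [div_eq_mul_inv] using hne m z hz)
    refine ⟨u, hu, fun z => eq_inv_of_mul_eq_one_left ?_⟩
    simpa [div_eq_mul_inv] using hu' z
  choose u hu hu' using hex
  refine (isClosed_polynomialClosure K).mem_of_tendsto (f := u) (b := atTop) ?_ (Eventually.of_forall hu)
  have hp : Tendsto (fun m : ℕ => s ^ (m + 1)) atTop (𝓝 0) :=
    (tendsto_add_atTop_iff_nat 1).2 (tendsto_pow_atTop_nhds_zero_of_lt_one hs0.le hs1)
  have hlim : Tendsto (fun m : ℕ => s ^ (m + 1) / (1 - s ^ (m + 1))) atTop (𝓝 0) := by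
    simpa [Pi.div_def] using hp.div (tendsto_const_nhds.sub hp) (by norm_num : (1 : ℝ) - 0 ≠ 0)
  rw [tendsto_iff_dist_tendsto_zero]
  refine squeeze_zero (fun _ => dist_nonneg) (fun m => ?_) hlim
  rw [ContinuousMap.dist_le (div_nonneg (by positivity) (by linarith [hlt m]))]
  intro z
  rw [dist_eq_norm, hu']
  rcases h z z.2 with hz | hz
  · rw [h1 z hz]
    refine norm_inv_one_sub_pow_sub_one_le (hlt m) ?_
    rwa [norm_div, norm_real, Real.norm_of_nonneg hρ.le, div_le_iff₀ hρ]
  · rw [h2 z hz, sub_zero]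
    refine norm_inv_one_sub_pow_le hs0 (hlt m) ?_
    rwa [norm_div, norm_real, Real.norm_of_nonneg hρ.le, mul_div_assoc', le_div_iff₀ hρ, one_mul]

/-- A continuous function which is `1` near `c` and `0` away from `c`. -/
theorem exists_continuousMap_bump (c : ℂ) {r r' : ℝ} (h : r < r') :
    ∃ χ : C(ℂ, ℂ), (∀ z, ‖z - c‖ ≤ r → χ z = 1) ∧ ∀ z, r' ≤ ‖z - c‖ → χ z = 0 := by
  have h0 : 0 < r' - r := by linarith
  refine ⟨⟨fun z => ((max 0 (min 1 ((r' - ‖z - c‖) / (r' - r))) : ℝ) : ℂ), by fun_prop⟩, ?_, ?_⟩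
  · intro z hz
    have : 1 ≤ (r' - ‖z - c‖) / (r' - r) := by rw [le_div_iff₀ h0]; linarith
    simp [min_eq_left this]
  · intro z hz
    have : (r' - ‖z - c‖) / (r' - r) ≤ 0 := div_nonpos_of_nonpos_of_nonneg (by linarith) h0.le
    simp [this]

/-- Runge approximation on a finite union of disjoint closed discs. -/
theorem exists_polynomial_near_on_closedBalls {ι : Type*} [Finite ι] {c : ι → ℂ} {r : ι → ℝ}
    (hr : ∀ i, 0 ≤ r i) (hd : ∀ i j, i ≠ j → r i + r j < dist (c i) (c j))
    (f : ι → C(ℂ, ℂ)) (hf : ∀ i, Differentiable ℂ (f i)) {ε : ℝ} (hε : 0 < ε) :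
    ∃ p : ℂ[X], ∀ i, ∀ z ∈ Metric.closedBall (c i) (r i), ‖p.eval z - f i z‖ < ε := by
  have := Fintype.ofFinite ι
  set K : Set ℂ := ⋃ i, Metric.closedBall (c i) (r i) with hKdef
  have hKc : IsPreconnected Kᶜ := isPreconnected_compl_iUnion_closedBall hr hd
  have : CompactSpace K := isCompact_iff_compactSpace.1
    (isCompact_iUnion fun i => isCompact_closedBall _ _)
  have hχ : ∀ i, ∃ χ : C(K, ℂ), χ ∈ polynomialClosure K ∧
      (∀ z : K, (z : ℂ) ∈ Metric.closedBall (c i) (r i) → χ z = 1) ∧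
      ∀ j, j ≠ i → ∀ z : K, (z : ℂ) ∈ Metric.closedBall (c j) (r j) → χ z = 0 := by
    intro i
    obtain ⟨r', hr', hd'⟩ : ∃ r' > r i, ∀ j, j ≠ i → r' + r j < dist (c i) (c j) := by
      have : ∀ᶠ r' in 𝓝[>] (r i), ∀ j, j ≠ i → r' + r j < dist (c i) (c j) := by
        refine Filter.eventually_all.2 fun j => ?_
        by_cases h : j = i
        · simp [h]
        have h1 : Tendsto (fun e : ℝ => e + r j) (𝓝[>] (r i)) (𝓝 (r i + r j)) :=
          ((continuous_id.add continuous_const).tendsto _).mono_left nhdsWithin_le_nhds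
        filter_upwards [h1.eventually_lt_const (hd i j (Ne.symm h))] with e he _ using he
      obtain ⟨e, h1, h2⟩ := (this.and self_mem_nhdsWithin).exists
      exact ⟨e, h2, h1⟩
    have hri := hr i
    set ρ := (r i + r') / 2 with hρ
    have hρ0 : 0 < ρ := by linarith
    have hr'0 : 0 < r' := by linarith
    obtain ⟨s, hs0, hs1, h1, h2⟩ : ∃ s, 0 < s ∧ s < 1 ∧ r i ≤ s * ρ ∧ ρ ≤ s * r' := by
      refine ⟨max (r i / ρ) (ρ / r'), lt_max_of_lt_right (by positivity), max_lt ?_ ?_, ?_, ?_⟩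
      · rw [div_lt_one hρ0]; linarith
      · rw [div_lt_one hr'0]; linarith
      · rw [← div_le_iff₀ hρ0]; exact le_max_left _ _
      · rw [← div_le_iff₀ hr'0]; exact le_max_right _ _
    have hlt : s * ρ < ρ / s := by
      rw [lt_div_iff₀ hs0]; nlinarith
    obtain ⟨χ, hχ1, hχ0⟩ := exists_continuousMap_bump (c i) hlt
    have hin : ∀ z ∈ Metric.closedBall (c i) (r i), ‖z - c i‖ ≤ s * ρ := fun z hz => by
      rw [Metric.mem_closedBall, dist_eq_norm] at hz; linarith
    have hout : ∀ j, j ≠ i → ∀ z ∈ Metric.closedBall (c j) (r j), ρ ≤ s * ‖z - c i‖ := by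
      intro j hj z hz
      rw [Metric.mem_closedBall] at hz
      have := hd' j hj
      have h3 := dist_triangle_left (c i) (c j) z
      have h4 : r' ≤ dist z (c i) := by linarith
      rw [← dist_eq_norm]
      exact h2.trans (by gcongr)
    refine ⟨χ.restrict K, mem_polynomialClosure_of_eq_indicator hKc hρ0 hs0 hs1 ?_
      (fun z hz => hχ1 z hz) (fun z hz => hχ0 z ((div_le_iff₀' hs0).2 hz)),
      fun z hz => hχ1 z (hin z hz), fun j hj z hz => hχ0 z ((div_le_iff₀' hs0).2 (hout j hj z hz))⟩
    intro z hz
    obtain ⟨j, hj⟩ := Set.mem_iUnion.1 hz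
    by_cases hji : j = i
    · subst hji; exact Or.inl (hin z hj)
    · exact Or.inr (hout j hji z hj)
  choose χ hχm hχ1 hχ0 using hχ
  obtain ⟨p, hp⟩ := exists_polynomial_of_mem_polynomialClosure
    (f := ∑ i, χ i * (f i).restrict K)
    (Subalgebra.sum_mem _ fun i _ => Subalgebra.mul_mem _ (hχm i)
      (restrict_mem_polynomialClosure K (f i) (hf i))) hε
  refine ⟨p, fun i z hz => ?_⟩
  have h := hp ⟨z, Set.mem_iUnion.2 ⟨i, hz⟩⟩
  rw [ContinuousMap.coe_sum, Finset.sum_apply, Finset.sum_eq_single i] at h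
  · simpa [hχ1 i ⟨z, Set.mem_iUnion.2 ⟨i, hz⟩⟩ hz] using h
  · intro j _ hj
    simp [hχ0 j i hj.symm ⟨z, Set.mem_iUnion.2 ⟨i, hz⟩⟩ hz]
  · simp

theorem eventually_exists_exp_rpow_mem {b : ℝ} (hb0 : 0 < b) (hb1 : b < 1) {q : ℝ} (hq : 1 < q) :
    ∀ᶠ t in atTop, ∃ n : ℕ, t ≤ Real.exp (((n : ℝ) + 1) ^ b) ∧
      Real.exp (((n : ℝ) + 1) ^ b) ≤ q * t := by
  have hq0 : 0 < q := by linarith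
  have hx : Tendsto (fun t : ℝ => (Real.log t) ^ (1 / b)) atTop atTop :=
    (tendsto_rpow_atTop (by positivity)).comp Real.tendsto_log_atTop
  have hsmall : Tendsto (fun x : ℝ => b * x ^ (-(1 - b))) atTop (𝓝 (b * 0)) :=
    (tendsto_rpow_neg_atTop (by linarith)).const_mul b
  rw [mul_zero] at hsmall
  have hlog := Real.log_pos hq
  filter_upwards [(hsmall.comp hx).eventually_le_const hlog, hx.eventually_gt_atTop 0,
    eventually_gt_atTop (1 : ℝ)] with t h1 h2 h3
  have ht0 : 0 < t := by linarith
  have hlt := Real.log_pos h3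
  set x := Real.log t ^ (1 / b) with hxdef
  have hxb : x ^ b = Real.log t := by
    rw [hxdef, ← Real.rpow_mul hlt.le]; simp [hb0.ne']
  obtain ⟨n, hn⟩ : ∃ n, n + 1 = ⌈x⌉₊ := Nat.exists_eq_add_one.2 (Nat.ceil_pos.2 h2) |>.imp fun _ h => h.symm
  have hn1 : x ≤ (n : ℝ) + 1 := by
    have := Nat.le_ceil x
    rw [← hn] at this; exact_mod_cast this
  have hn2 : (n : ℝ) + 1 ≤ x + 1 := by
    have := (Nat.ceil_lt_add_one h2.le).le
    rw [← hn] at this; exact_mod_cast this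
  refine ⟨n, ?_, ?_⟩
  · calc t = Real.exp (x ^ b) := by rw [hxb, Real.exp_log ht0]
      _ ≤ _ := Real.exp_le_exp.2 (Real.rpow_le_rpow h2.le hn1 hb0.le)
  · calc Real.exp (((n : ℝ) + 1) ^ b) ≤ Real.exp (Real.log q + Real.log t) := ?_
      _ = q * t := by rw [Real.exp_add, Real.exp_log hq0, Real.exp_log ht0]
    refine Real.exp_le_exp.2 ?_
    calc ((n : ℝ) + 1) ^ b ≤ (x + 1) ^ b := Real.rpow_le_rpow (by positivity) hn2 hb0.le
      _ = x ^ b * (1 + 1 / x) ^ b := by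
        rw [← Real.mul_rpow h2.le (by positivity)]; congr 1; field_simp
      _ ≤ x ^ b * (1 + b * (1 / x)) := by
        gcongr
        have : 0 ≤ 1 / x := by positivity
        exact rpow_one_add_le_one_add_mul_self (by linarith) hb0.le hb1.le
      _ = b * x ^ (-(1 - b)) + x ^ b := by
        rw [show -(1 - b) = b - 1 by ring, Real.rpow_sub_one h2.ne']; ring
      _ ≤ Real.log q + Real.log t := by
        rw [hxb]; exact add_le_add h1 le_rfl

/-- A labelling of `ℤ × ℤ` by the classes modulo `K`. -/
theorem exists_label_mod (K : ℕ) (hK : 0 < K) : ∃ (M : ℕ) (j : ℤ × ℤ → ℕ), (∀ p, j p < M) ∧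
    ∀ p p', j p = j p' → (K : ℤ) ∣ p.1 - p'.1 ∧ (K : ℤ) ∣ p.2 - p'.2 := by
  have : NeZero K := ⟨hK.ne'⟩
  refine ⟨Fintype.card (ZMod K × ZMod K),
    fun p => Fintype.equivFin (ZMod K × ZMod K) ((p.1 : ZMod K), (p.2 : ZMod K)),
    fun p => Fin.is_lt _, fun p p' h => ?_⟩
  have h1 := (Fintype.equivFin (ZMod K × ZMod K)).injective (Fin.ext h)
  simp only [Prod.mk.injEq] at h1
  refine ⟨?_, ?_⟩
  · exact (ZMod.intCast_eq_intCast_iff_dvd_sub _ _ _).1 h1.1.symm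
  · exact (ZMod.intCast_eq_intCast_iff_dvd_sub _ _ _).1 h1.2.symm

theorem le_norm_sub_of_dvd {K : ℕ} {p p' : ℤ × ℤ} (hne : p ≠ p') (h1 : (K : ℤ) ∣ p.1 - p'.1)
    (h2 : (K : ℤ) ∣ p.2 - p'.2) :
    (K : ℝ) ≤ ‖((p.1 : ℂ) + p.2 * I) - ((p'.1 : ℂ) + p'.2 * I)‖ := by
  have key : ∀ m : ℤ, (K : ℤ) ∣ m → m ≠ 0 → (K : ℝ) ≤ |(m : ℝ)| := by
    intro m hm h0
    have := Int.le_of_dvd (abs_pos.2 h0) ((dvd_abs _ _).2 hm)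
    exact_mod_cast this
  by_cases h : p.1 = p'.1
  · have h' : p.2 ≠ p'.2 := fun h' => hne (Prod.ext h h')
    have := (key _ h2 (sub_ne_zero.2 h')).trans_eq ?_ |>.trans
      (abs_im_le_norm (((p.1 : ℂ) + p.2 * I) - ((p'.1 : ℂ) + p'.2 * I)))
    · exact this
    · simp
  · have := (key _ h1 (sub_ne_zero.2 h)).trans_eq ?_ |>.trans
      (abs_re_le_norm (((p.1 : ℂ) + p.2 * I) - ((p'.1 : ℂ) + p'.2 * I)))
    · exact this
    · simp

theorem exists_lattice_near {h : ℝ} (hh : 0 < h) (a : ℂ) :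
    ∃ p : ℤ × ℤ, ‖a - h * ((p.1 : ℂ) + p.2 * I)‖ ≤ h := by
  have key : ∀ x : ℝ, |x - h * round (x / h)| ≤ h / 2 := by
    intro x
    have h1 := abs_sub_round (x / h)
    have : x - h * round (x / h) = h * (x / h - round (x / h)) := by field_simp
    rw [this, abs_mul, abs_of_pos hh]
    nlinarith
  refine ⟨(round (a.re / h), round (a.im / h)), ?_⟩
  refine (norm_le_abs_re_add_abs_im _).trans ?_
  have h1 := key a.re
  have h2 := key a.im
  have e1 : (a - h * (((round (a.re / h) : ℤ) : ℂ) + (round (a.im / h) : ℤ) * I)).re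
      = a.re - h * round (a.re / h) := by simp
  have e2 : (a - h * (((round (a.re / h) : ℤ) : ℂ) + (round (a.im / h) : ℤ) * I)).im
      = a.im - h * round (a.im / h) := by simp
  simp only [e1, e2]
  linarith

theorem finite_lattice_near {h : ℝ} (hh : 0 < h) (a : ℂ) (s : ℝ) :
    {p : ℤ × ℤ | ‖(h : ℂ) * ((p.1 : ℂ) + p.2 * I) - a‖ ≤ s}.Finite := by
  obtain ⟨m, hm⟩ := exists_nat_ge ((s + ‖a‖) / h)
  refine ((Set.finite_Icc (-(m : ℤ)) m).prod (Set.finite_Icc (-(m : ℤ)) m)).subset ?_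
  rintro ⟨u, v⟩ hp
  simp only [Set.mem_ofPred_eq] at hp
  have h1 : ‖(h : ℂ) * ((u : ℂ) + v * I)‖ ≤ s + ‖a‖ := by
    have := norm_sub_norm_le ((h : ℂ) * ((u : ℂ) + v * I)) a
    linarith
  rw [norm_mul, norm_real, Real.norm_of_nonneg hh.le, ← le_div_iff₀' hh] at h1
  have hu := (abs_re_le_norm ((u : ℂ) + v * I)).trans (h1.trans hm)
  have hv := (abs_im_le_norm ((u : ℂ) + v * I)).trans (h1.trans hm)
  simp at hu hv
  have hu' : |u| ≤ (m : ℤ) := by exact_mod_cast hu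
  have hv' : |v| ≤ (m : ℤ) := by exact_mod_cast hv
  exact ⟨abs_le.1 hu', abs_le.1 hv'⟩

theorem exists_one_lt_pow_le_two (M : ℕ) : ∃ q : ℝ, 1 < q ∧ q ^ M ≤ 2 := by
  have : ∀ᶠ q in 𝓝[>] (1 : ℝ), q ^ M < 2 :=
    ((continuous_pow M).tendsto (1 : ℝ)).mono_left nhdsWithin_le_nhds
      |>.eventually_lt_const (by norm_num)
  obtain ⟨q, h1, h2⟩ := (this.and self_mem_nhdsWithin).exists
  exact ⟨q, h2, h1.le⟩

/-- If the ratios of consecutive terms of `lam` tend to one, then for all `a` in some disc around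
`a₀` a multiple `lam n * a` comes close to a finite separated set far from the origin. -/
theorem exists_separated_finset {lam : ℕ → ℝ}
    (hlam : ∀ q > 1, ∀ᶠ t in atTop, ∃ n, t ≤ lam n ∧ lam n ≤ q * t) {ρ δ : ℝ} (hρ : 0 < ρ)
    (hδ : 0 < δ) {a₀ : ℂ} (ha₀ : a₀ ≠ 0) :
    ∃ s > 0, ∀ N : ℝ, ∃ C : Finset ℂ, (∀ c ∈ C, N < ‖c‖) ∧
      (∀ c ∈ C, ∀ c' ∈ C, c ≠ c' → ρ < dist c c') ∧
      ∀ a ∈ Metric.closedBall a₀ s, ∃ n, ∃ c ∈ C, ‖lam n * a - c‖ ≤ δ := by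
  obtain ⟨K, hK⟩ := exists_nat_gt (4 * ρ / δ)
  have hK0 : (0 : ℝ) < K := lt_trans (by positivity) hK
  rw [div_lt_iff₀ hδ] at hK
  obtain ⟨M, j, hjM, hj⟩ := exists_label_mod K (by exact_mod_cast hK0)
  obtain ⟨q, hq1, hq2⟩ := exists_one_lt_pow_le_two (2 * M)
  have hA : 0 < ‖a₀‖ := norm_pos_iff.2 ha₀
  obtain ⟨s, hs⟩ : ∃ s, s = (q - 1) * ‖a₀‖ / (4 * (q + 1)) := ⟨_, rfl⟩
  have hs0 : 0 < s := by rw [hs]; exact div_pos (mul_pos (by linarith) hA) (by linarith)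
  have hs1 : 4 * (q + 1) * s = (q - 1) * ‖a₀‖ := by
    have : q + 1 ≠ 0 := by linarith
    rw [hs]; field_simp
  have hs2 : 4 * s ≤ ‖a₀‖ := by nlinarith
  refine ⟨s, hs0, fun N => ?_⟩
  obtain ⟨Λ, hΛ, hΛ1, hΛ2, hΛ3, hΛ0⟩ : ∃ Λ : ℝ, (∀ t ≥ Λ, ∃ n, t ≤ lam n ∧ lam n ≤ q * t) ∧
      2 * ρ / (K * s) ≤ Λ ∧ (2 * N + 1) / ‖a₀‖ ≤ Λ ∧ 3 * ρ / ((q - 1) * ‖a₀‖) ≤ Λ ∧ 0 < Λ := by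
    refine Filter.Eventually.exists (f := atTop) ?_
    filter_upwards [eventually_forall_ge_atTop.2 (hlam q hq1), eventually_ge_atTop _,
      eventually_ge_atTop _, eventually_ge_atTop _, eventually_gt_atTop 0] with Λ h1 h2 h3 h4 h5
    exact ⟨h1, h2, h3, h4, h5⟩
  have hq0 : 0 < q := by linarith
  have hlevel : ∀ i : ℕ, ∃ n, Λ * q ^ (2 * i) ≤ lam n ∧ lam n ≤ q * (Λ * q ^ (2 * i)) := fun i =>
    hΛ _ (le_mul_of_one_le_right hΛ0.le (one_le_pow₀ hq1.le))
  choose n hn1 hn2 using hlevel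
  have hge : ∀ i, Λ ≤ lam (n i) := fun i =>
    (le_mul_of_one_le_right hΛ0.le (one_le_pow₀ hq1.le)).trans (hn1 i)
  have hle : ∀ i < M, lam (n i) ≤ 2 * Λ := fun i hi => by
    have h1 : q ^ (2 * i + 1) ≤ q ^ (2 * M) := pow_le_pow_right₀ hq1.le (by omega)
    calc lam (n i) ≤ q * (Λ * q ^ (2 * i)) := hn2 i
      _ = Λ * q ^ (2 * i + 1) := by ring
      _ ≤ Λ * 2 := by gcongr; exact h1.trans hq2
      _ = 2 * Λ := mul_comm _ _
  have hratio : ∀ i i', i < i' → q * lam (n i) ≤ lam (n i') := fun i i' hi => by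
    have h1 : q ^ (2 * i + 2) ≤ q ^ (2 * i') := pow_le_pow_right₀ hq1.le (by omega)
    calc q * lam (n i) ≤ q * (q * (Λ * q ^ (2 * i))) := by gcongr; exact hn2 i
      _ = Λ * q ^ (2 * i + 2) := by ring
      _ ≤ Λ * q ^ (2 * i') := by gcongr
      _ ≤ _ := hn1 i'
  obtain ⟨h, hh⟩ : ∃ h, h = 2 * ρ / (K * Λ) := ⟨_, rfl⟩
  have hh0 : 0 < h := by rw [hh]; positivity
  have hhK : Λ * (h * K) = 2 * ρ := by rw [hh]; field_simp
  have hhs : h ≤ s := by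
    rw [hh, div_le_iff₀ (by positivity)]
    rw [div_le_iff₀ (by positivity)] at hΛ1
    linarith
  rw [div_le_iff₀ hA] at hΛ2
  rw [div_le_iff₀ (mul_pos (by linarith) hA)] at hΛ3
  set x : ℤ × ℤ → ℂ := fun p => h * ((p.1 : ℂ) + p.2 * I) with hx
  set P := (finite_lattice_near hh0 a₀ (2 * s)).toFinset with hP
  have hPmem : ∀ p, p ∈ P ↔ ‖x p - a₀‖ ≤ 2 * s := fun p => by simp [hP, hx]
  have hxl : ∀ p ∈ P, ‖a₀‖ - 2 * s ≤ ‖x p‖ := fun p hp => by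
    have := norm_sub_norm_le a₀ (x p)
    rw [norm_sub_rev] at this
    linarith [(hPmem p).1 hp]
  have hxu : ∀ p ∈ P, ‖x p‖ ≤ ‖a₀‖ + 2 * s := fun p hp => by
    linarith [norm_sub_norm_le (x p) a₀, (hPmem p).1 hp]
  have hnorm : ∀ p, ‖(lam (n (j p)) : ℂ) * x p‖ = lam (n (j p)) * ‖x p‖ := fun p => by
    rw [norm_mul, norm_real, Real.norm_of_nonneg (hΛ0.le.trans (hge _))]
  have hfar : ∀ p ∈ P, ∀ p' ∈ P, j p < j p' →
      ρ < ‖(lam (n (j p')) : ℂ) * x p' - lam (n (j p)) * x p‖ := fun p hp p' hp' hlt => by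
    have h1 := norm_sub_norm_le ((lam (n (j p')) : ℂ) * x p') (lam (n (j p)) * x p)
    rw [hnorm, hnorm] at h1
    have h2 := hratio _ _ hlt
    have h3 := hge (j p)
    have h4 : lam (n (j p)) * ‖x p‖ ≤ lam (n (j p)) * (‖a₀‖ + 2 * s) := by
      gcongr
      · linarith
      · exact hxu p hp
    have h5 : q * lam (n (j p)) * (‖a₀‖ - 2 * s) ≤ lam (n (j p')) * ‖x p'‖ := by
      refine mul_le_mul h2 (hxl p' hp') (by linarith) (by linarith [hge (j p')])
    have h6 : lam (n (j p)) * ((q - 1) * ‖a₀‖) ≥ Λ * ((q - 1) * ‖a₀‖) := by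
      have : 0 ≤ (q - 1) * ‖a₀‖ := mul_nonneg (by linarith) hA.le
      gcongr
    have h7 : q * lam (n (j p)) * (‖a₀‖ - 2 * s) - lam (n (j p)) * (‖a₀‖ + 2 * s)
        = lam (n (j p)) * ((q - 1) * ‖a₀‖) - lam (n (j p)) * (4 * (q + 1) * s) / 2 := by ring
    rw [hs1] at h7
    linarith
  refine ⟨P.image fun p => (lam (n (j p)) : ℂ) * x p, ?_, ?_, ?_⟩
  · simp only [Finset.forall_mem_image]
    intro p hp
    rw [hnorm]
    have := hxl p hp
    have h2 : Λ * (‖a₀‖ / 2) ≤ lam (n (j p)) * ‖x p‖ :=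
      mul_le_mul (hge _) (by linarith) (by positivity) (hΛ0.le.trans (hge _))
    linarith
  · simp only [Finset.forall_mem_image]
    intro p hp p' hp' hne
    rw [dist_eq_norm]
    rcases lt_trichotomy (j p) (j p') with hlt | heq | hlt
    · rw [norm_sub_rev]; exact hfar p hp p' hp' hlt
    · have hpp : p ≠ p' := fun e => hne (by rw [e])
      have h1 := le_norm_sub_of_dvd hpp (hj p p' heq).1 (hj p p' heq).2
      rw [heq, ← mul_sub, norm_mul, norm_real, Real.norm_of_nonneg (hΛ0.le.trans (hge _))]
      simp only [hx]
      rw [← mul_sub, norm_mul, norm_real, Real.norm_of_nonneg hh0.le]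
      have h2 : Λ * (h * K) ≤ lam (n (j p')) * (h * ‖((p.1 : ℂ) + p.2 * I) - ((p'.1 : ℂ) + p'.2 * I)‖) := by
        have := hΛ0.le.trans (hge (j p'))
        gcongr
        exact hge _
      linarith
    · exact hfar p' hp' p hp hlt
  · intro a ha
    rw [Metric.mem_closedBall, dist_eq_norm] at ha
    obtain ⟨p, hp⟩ := exists_lattice_near hh0 a
    have hpP : p ∈ P := by
      rw [hPmem]
      have : x p - a₀ = (a - a₀) - (a - x p) := by ring
      rw [this]
      exact (norm_sub_le _ _).trans (by linarith)
    refine ⟨n (j p), _, Finset.mem_image_of_mem _ hpP, ?_⟩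
    rw [← mul_sub, norm_mul, norm_real, Real.norm_of_nonneg (hΛ0.le.trans (hge _))]
    have h1 : lam (n (j p)) * ‖a - x p‖ ≤ 2 * Λ * h :=
      mul_le_mul (hle _ (hjM p)) hp (norm_nonneg _) (by positivity)
    refine h1.trans (le_of_mul_le_mul_right ?_ hK0)
    nlinarith

theorem isClosed_setOf_differentiable :
    IsClosed {f : C(ℂ, ℂ) | Differentiable ℂ (f : ℂ → ℂ)} := by
  refine isClosed_of_closure_subset fun f hf => ?_
  obtain ⟨F, hF, hlim⟩ := mem_closure_iff_seq_limit.1 hf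
  rw [ContinuousMap.tendsto_iff_tendstoLocallyUniformly, ← tendstoLocallyUniformlyOn_univ] at hlim
  exact differentiableOn_univ.1 (hlim.differentiableOn
    (Eventually.of_forall fun n => (hF n).differentiableOn) isOpen_univ)

instance : BaireSpace Hc := by
  have h : IsClosedEmbedding (Subtype.val : Hc → C(ℂ, ℂ)) :=
    isClosed_setOf_differentiable.isClosedEmbedding_subtypeVal
  have := h.IsCompletelyPseudoMetrizableSpace
  infer_instance

instance : SecondCountableTopology Hc :=
  (IsEmbedding.subtypeVal
    (p := fun f : C(ℂ, ℂ) => Differentiable ℂ (f : ℂ → ℂ))).secondCountableTopology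

theorem isOpen_setOf_norm_sub_lt (g : C(ℂ, ℂ)) {K : Set ℂ} (hK : IsCompact K) (ε : ℝ) :
    IsOpen {f : C(ℂ, ℂ) | ∀ z ∈ K, ‖f z - g z‖ < ε} := by
  have h := (ContinuousMap.isOpen_setOfPred_mapsTo (X := ℂ) (Y := ℂ) hK
    (Metric.isOpen_ball (x := (0 : ℂ)) (ε := ε))).preimage
      (continuous_id.sub (continuous_const (y := g)))
  convert h using 1
  ext f
  simp [Set.MapsTo]

theorem exists_closedBall_of_mem_nhds {U : Set Hc} {f : Hc} (hU : U ∈ 𝓝 f) :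
    ∃ R ε : ℝ, 0 < R ∧ 0 < ε ∧ ∀ g : Hc, (∀ z ∈ Metric.closedBall 0 R, ‖g.1 z - f.1 z‖ < ε) →
      g ∈ U := by
  rw [nhds_subtype_eq_comap, Filter.mem_comap] at hU
  obtain ⟨V, hV, hVU⟩ := hU
  obtain ⟨⟨K, ε⟩, ⟨hK, hε⟩, hKV⟩ :=
    (nhds_basis_uniformity Metric.uniformity_basis_dist.compactConvergenceUniformity).mem_iff.1 hV
  obtain ⟨R, hR⟩ := hK.isBounded.subset_closedBall (0 : ℂ)
  refine ⟨max R 1, ε, by positivity, hε, fun g hg => hVU (hKV fun z hz => ?_)⟩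
  have := hg z (Metric.closedBall_subset_closedBall (le_max_left _ _) (hR hz))
  rwa [← dist_eq_norm] at this

/-- The functions with, for every `a ∈ B`, a translate by a multiple `lam n * a` close to `g`. -/
def approximants (lam : ℕ → ℂ) (B : Set ℂ) (g : Hc) (R ε : ℝ) : Set Hc :=
  {f | ∀ a ∈ B, ∃ n, ∀ z ∈ Metric.closedBall 0 R, ‖f.1 (z + lam n * a) - g.1 z‖ < ε}

theorem isOpen_approximants (lam : ℕ → ℂ) {B : Set ℂ} (hB : IsCompact B) (g : Hc) (R ε : ℝ) :
    IsOpen (approximants lam B g R ε) := by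
  have hW : IsOpen {x : Hc × ℂ | ∃ n, ∀ z ∈ Metric.closedBall 0 R,
      ‖x.1.1 (z + lam n * x.2) - g.1 z‖ < ε} := by
    simp only [Set.ofPred_exists]
    refine isOpen_iUnion fun n => ?_
    have hc : Continuous fun x : Hc × ℂ =>
        (⟨fun z => x.1.1 (z + lam n * x.2), by fun_prop⟩ : C(ℂ, ℂ)) := by
      refine ContinuousMap.continuous_of_continuous_uncurry _ ?_
      simp only [Function.uncurry_def, ContinuousMap.coe_mk]
      fun_prop
    exact (isOpen_setOf_norm_sub_lt g.1 (isCompact_closedBall 0 R) ε).preimage hc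
  rw [isOpen_iff_mem_nhds]
  intro f hf
  exact hB.eventually_forall_of_forall_eventually fun a ha => hW.mem_nhds (hf a ha)

theorem exists_dense_approximants {lam : ℕ → ℝ}
    (hlam : ∀ q > 1, ∀ᶠ t in atTop, ∃ n, t ≤ lam n ∧ lam n ≤ q * t) (g : Hc) {R ε : ℝ}
    (hR : 0 < R) (hε : 0 < ε) {a₀ : ℂ} (ha₀ : a₀ ≠ 0) :
    ∃ s > 0, Dense (approximants (fun n => (lam n : ℂ)) (Metric.closedBall a₀ s) g R ε) := by
  obtain ⟨δ, hδ0, hδ1, hδ⟩ : ∃ δ > 0, δ ≤ 1 ∧ ∀ z ∈ Metric.closedBall (0 : ℂ) (R + 1),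
      ∀ w ∈ Metric.closedBall (0 : ℂ) (R + 1), ‖z - w‖ ≤ δ → ‖g.1 z - g.1 w‖ < ε / 2 := by
    have := (isCompact_closedBall (0 : ℂ) (R + 1)).uniformContinuousOn_of_continuous
      g.1.continuous.continuousOn
    obtain ⟨δ, h0, h⟩ := Metric.uniformContinuousOn_iff.1 this (ε / 2) (by positivity)
    refine ⟨min 1 (δ / 2), by positivity, min_le_left _ _, fun z hz w hw hzw => ?_⟩
    rw [← dist_eq_norm] at hzw ⊢
    exact h z hz w hw (hzw.trans_lt ((min_le_right _ _).trans_lt (by linarith)))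
  obtain ⟨s, hs0, hs⟩ := exists_separated_finset hlam (ρ := 2 * (R + 1)) (by linarith) hδ0 ha₀
  refine ⟨s, hs0, fun f => mem_closure_iff_nhds.2 fun U hU => ?_⟩
  obtain ⟨N, η, hN0, hη0, hU⟩ := exists_closedBall_of_mem_nhds hU
  obtain ⟨C, hC1, hC2, hC3⟩ := hs (N + (R + 1))
  have hfar : ∀ c ∈ C, N + (R + 1) < dist c 0 := fun c hc => by
    rw [dist_zero_right]; exact hC1 c hc
  obtain ⟨p, hp⟩ := exists_polynomial_near_on_closedBalls (ι := Option C)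
    (c := fun i => i.elim 0 (fun c => (c : ℂ))) (r := fun i => i.elim N fun _ => R + 1)
    (by rintro (_ | c) <;> simp <;> linarith)
    (by
      rintro (_ | c) (_ | c') h
      · exact absurd rfl h
      · simpa [dist_comm] using hfar c' c'.2
      · have := hfar c c.2
        simp only [Option.elim]
        linarith
      · have := hC2 c c.2 c' c'.2 fun e => h (by rw [Subtype.ext e])
        simp only [Option.elim]
        linarith)
    (fun i => i.elim f.1 fun c => (translateH g (-(c : ℂ))).1)
    (by
      rintro (_ | c)
      · exact f.2
      · exact (translateH g (-(c : ℂ))).2)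
    (ε := min η (ε / 2)) (by positivity)
  refine ⟨⟨⟨fun z => p.eval z, p.continuous⟩, p.differentiable⟩, hU _ fun z hz =>
    (hp none z hz).trans_le (min_le_left _ _), fun a ha => ?_⟩
  obtain ⟨n, c, hc, hnc⟩ := hC3 a ha
  refine ⟨n, fun z hz => ?_⟩
  rw [mem_closedBall_zero_iff] at hz
  have hzc : ‖z + lam n * a - c‖ ≤ R + 1 := by
    rw [add_sub_assoc]
    exact (norm_add_le _ _).trans (by linarith)
  have h1 := (hp (some ⟨c, hc⟩) (z + lam n * a) (by
    rw [Metric.mem_closedBall, dist_eq_norm]; exact hzc)).trans_le (min_le_right _ _)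
  have h2 := hδ (z + lam n * a - c) (mem_closedBall_zero_iff.2 hzc) z
    (mem_closedBall_zero_iff.2 (by linarith))
    (by rwa [show z + lam n * a - c - z = lam n * a - c by ring])
  have h3 : ‖p.eval (z + lam n * a) - g.1 (z + lam n * a - c)‖ < ε / 2 := by
    simpa [translateH, sub_eq_add_neg] using h1
  calc ‖p.eval (z + lam n * a) - g.1 z‖
      ≤ ‖p.eval (z + lam n * a) - g.1 (z + lam n * a - c)‖ + ‖g.1 (z + lam n * a - c) - g.1 z‖ :=
        norm_sub_le_norm_sub_add_norm_sub _ _ _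
    _ < ε := by linarith

theorem exists_forall_mem_HC {lam : ℕ → ℝ}
    (hlam : ∀ q > 1, ∀ᶠ t in atTop, ∃ n, t ≤ lam n ∧ lam n ≤ q * t) :
    ∃ f : Hc, ∀ a : ℂ, a ≠ 0 → f ∈ HC (fun n => (lam n : ℂ)) a := by
  have : Nonempty Hc := ⟨⟨0, differentiable_const 0⟩⟩
  obtain ⟨g, hg⟩ := TopologicalSpace.exists_dense_seq Hc
  have hex : ∀ (k m : ℕ) (a₀ : {a : ℂ // a ≠ 0}), ∃ s > 0, Dense (approximants
      (fun n => (lam n : ℂ)) (Metric.closedBall (a₀ : ℂ) s) (g k) (m + 1) (1 / (m + 1))) := fun k m a₀ =>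
    exists_dense_approximants hlam (g k) (by positivity) (by positivity) a₀.2
  choose s hs0 hs using hex
  have hcov : ∀ k m, ∃ t : Set {a : ℂ // a ≠ 0}, t.Countable ∧
      ∀ a : ℂ, a ≠ 0 → ∃ a₀ ∈ t, a ∈ Metric.closedBall (a₀ : ℂ) (s k m a₀) := by
    intro k m
    obtain ⟨t, ht, h⟩ := TopologicalSpace.countable_cover_nhds
      (f := fun a₀ : {a : ℂ // a ≠ 0} => Metric.closedBall a₀ (s k m a₀))
      fun a₀ => Metric.closedBall_mem_nhds _ (hs0 k m a₀)
    refine ⟨t, ht, fun a ha => ?_⟩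
    have := h.ge (Set.mem_univ ⟨a, ha⟩)
    simp only [Set.mem_iUnion] at this
    obtain ⟨a₀, h1, h2⟩ := this
    exact ⟨a₀, h1, h2⟩
  choose t ht hcov using hcov
  have hdense : Dense (⋂ (km : ℕ × ℕ), ⋂ a₀ ∈ t km.1 km.2, approximants (fun n => (lam n : ℂ))
      (Metric.closedBall (a₀ : ℂ) (s km.1 km.2 a₀)) (g km.1) (km.2 + 1) (1 / (km.2 + 1))) := by
    have hopen : ∀ (km : ℕ × ℕ) (a₀ : {a : ℂ // a ≠ 0}), IsOpen (approximants (fun n => (lam n : ℂ))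
        (Metric.closedBall (a₀ : ℂ) (s km.1 km.2 a₀)) (g km.1) (km.2 + 1) (1 / (km.2 + 1))) :=
      fun km a₀ => isOpen_approximants _ (isCompact_closedBall _ _) _ _ _
    refine dense_iInter_of_Gδ
      (fun km => .biInter (ht km.1 km.2) fun a₀ _ => (hopen km a₀).isGδ) fun km => ?_
    exact dense_biInter_of_isOpen (fun a₀ _ => hopen km a₀) (ht km.1 km.2) fun a₀ _ => hs _ _ _
  obtain ⟨f, hf⟩ := hdense.nonempty
  simp only [Set.mem_iInter] at hf
  refine ⟨f, fun a ha => ?_⟩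
  have hmem : ∀ k m : ℕ, ∃ n, ∀ z ∈ Metric.closedBall 0 ((m : ℝ) + 1),
      ‖f.1 (z + lam n * a) - (g k).1 z‖ < 1 / ((m : ℝ) + 1) := by
    intro k m
    obtain ⟨a₀, h1, h2⟩ := hcov k m a ha
    exact hf (k, m) a₀ h1 a h2
  refine Dense.of_closure (hg.mono ?_)
  rintro _ ⟨k, rfl⟩
  refine mem_closure_iff_nhds.2 fun U hU => ?_
  obtain ⟨R, ε, hR, hε, hU⟩ := exists_closedBall_of_mem_nhds hU
  obtain ⟨m₁, hm₁⟩ := exists_nat_ge R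
  obtain ⟨m₂, hm₂⟩ := exists_nat_one_div_lt hε
  obtain ⟨n, hn⟩ := hmem k (max m₁ m₂)
  refine ⟨_, hU (translateH f (lam n * a)) fun z hz =>
    (hn z ?_).trans (lt_of_le_of_lt ?_ hm₂), n, rfl⟩
  · refine Metric.closedBall_subset_closedBall ?_ hz
    have : (m₁ : ℝ) ≤ (max m₁ m₂ : ℕ) := by exact_mod_cast le_max_left _ _
    linarith
  · have : (m₂ : ℝ) ≤ (max m₁ m₂ : ℕ) := by exact_mod_cast le_max_right _ _
    gcongr

theorem common_hypercyclic_exp_pow (b : ℝ) (hb0 : 0 < b) (hb1 : b < 1) :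
    ∃ f : Hc, ∀ a : ℂ, a ≠ 0 →
      f ∈ HC (fun n : ℕ => ((Real.exp (((n : ℝ) + 1) ^ b) : ℝ) : ℂ)) a :=
  exists_forall_mem_HC fun _ hq => eventually_exists_exp_rpow_mem hb0 hb1 hq
end
end

section
/- Let p be a non-constant polynomial with complex coefficients such that p(n) ≠ 0 for every n ∈ ℕ. Then the set ⋂_{a ∈ ℂ\{0}} HC({T_{p(n) a}}) is a Gδ and dense subset of H(ℂ); in particular, there exists an entire function f such that for every a ∈ ℂ\{0} the set {z ↦ f(z + p(n) a) : n = 1, 2, …} is dense in H(ℂ). -/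
open Complex Filter Topology Set Polynomial

noncomputable section

/-- The continuous functions on `K` that are restrictions of entire functions. -/
def entireSubalgebra (K : Set ℂ) : Subalgebra ℂ C(K, ℂ) where
  carrier := {f | ∃ F : ℂ → ℂ, Differentiable ℂ F ∧ ∀ x : K, f x = F x}
  mul_mem' := by
    rintro f g ⟨F, hF, hf⟩ ⟨G, hG, hg⟩
    exact ⟨fun z => F z * G z, hF.mul hG, fun x => by simp [hf, hg]⟩
  add_mem' := by
    rintro f g ⟨F, hF, hf⟩ ⟨G, hG, hg⟩
    exact ⟨fun z => F z + G z, hF.add hG, fun x => by simp [hf, hg]⟩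
  algebraMap_mem' c := ⟨fun _ => c, differentiable_const c, fun x => by simp⟩

/-- If the vertical lines through the zeros of the entire function `F` avoid the compact set `K`,
then `1 / F` is a uniform limit on `K` of entire functions. -/
theorem exists_entire_approx_inv {K : Set ℂ} (hK : IsCompact K) {F : ℂ → ℂ}
    (hF : Differentiable ℂ F) (hzero : ∀ w, F w = 0 → ∀ z ∈ K, z.re ≠ w.re)
    {ε : ℝ} (hε : 0 < ε) :
    ∃ φ : ℂ → ℂ, Differentiable ℂ φ ∧ ∀ z ∈ K, ‖φ z - (F z)⁻¹‖ < ε := by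
  have : CompactSpace K := isCompact_iff_compactSpace.mp hK
  let S : Subalgebra ℂ C(K, ℂ) := (entireSubalgebra K).topologicalClosure
  have hS : IsClosed (S : Set C(K, ℂ)) := (entireSubalgebra K).isClosed_topologicalClosure
  have : CompleteSpace S := hS.completeSpace_coe
  let res (G : ℂ → ℂ) (hG : Differentiable ℂ G) : S :=
    ⟨⟨fun x => G x, hG.continuous.comp continuous_subtype_val⟩,
      (entireSubalgebra K).le_topologicalClosure ⟨G, hG, fun _ => rfl⟩⟩
  have hunit : IsUnit (res F hF) := by
    by_contra hnot
    obtain ⟨χ, hχ⟩ := WeakDual.CharacterSpace.exists_apply_eq_zero hnot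
    let Z : S := res id differentiable_id
    set w : ℂ := χ Z with hw
    have hdslope : Differentiable ℂ (dslope F w) := by
      rw [← differentiableOn_univ] at hF ⊢
      exact (Complex.differentiableOn_dslope univ_mem).mpr hF
    have hfac : res F hF = algebraMap ℂ S (F w) + (Z - algebraMap ℂ S w) * res _ hdslope := by
      ext x
      have := sub_smul_dslope F w (x : ℂ)
      rw [smul_eq_mul] at this
      change F x = F w + ((x : ℂ) - w) * dslope F w x
      rw [this]; ring
    have hFw : F w = 0 := by
      have h2 := congrArg χ hfac
      rw [hχ, map_add, map_mul, map_sub, AlgHomClass.commutes, AlgHomClass.commutes, ← hw] at h2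
      simpa using h2.symm
    have hmem : w ∈ spectrum ℂ Z := AlgHom.apply_mem_spectrum χ Z
    have hbdd := Subalgebra.spectrum_isBounded_connectedComponentIn S Z hmem
    have hsub : {z : ℂ | z.re = w.re} ⊆
        connectedComponentIn (spectrum ℂ (Z : C(K, ℂ)))ᶜ w := by
      refine IsPreconnected.subset_connectedComponentIn ?_ rfl ?_
      · have : {z : ℂ | z.re = w.re} = {z | z.re ≤ w.re} ∩ {z | w.re ≤ z.re} := by
          ext z; simp [le_antisymm_iff]
        rw [this]
        exact ((convex_halfSpace_re_le _).inter (convex_halfSpace_re_ge _)).isPreconnected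
      · intro z hz hmem
        rw [ContinuousMap.spectrum_eq_range] at hmem
        obtain ⟨x, rfl⟩ := hmem
        exact hzero w hFw x x.2 hz
    obtain ⟨C, hC⟩ := (hbdd.subset hsub).exists_norm_le
    have h1 := hC (w.re + (|C| + 1 : ℝ) * I) (by simp)
    have h2 := Complex.abs_im_le_norm (w.re + (|C| + 1 : ℝ) * I)
    simp only [add_im, ofReal_im, mul_im, ofReal_re, I_im, mul_one, I_re, mul_zero, add_zero,
      zero_add] at h2
    have := le_abs_self C
    have := le_abs_self (|C| + 1)
    linarith
  obtain ⟨G, hG⟩ := hunit.exists_right_inv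
  obtain ⟨ψ, ⟨φ, hφ, hψ⟩, hdist⟩ := Metric.mem_closure_iff.mp G.2 ε hε
  refine ⟨φ, hφ, fun z hz => ?_⟩
  have hGz : F z * (G : C(K, ℂ)) ⟨z, hz⟩ = 1 := by
    have := congrArg (fun f : S => (f : C(K, ℂ)) ⟨z, hz⟩) hG
    exact this
  rw [← eq_inv_of_mul_eq_one_right hGz, ← hψ ⟨z, hz⟩, ← dist_eq_norm, dist_comm]
  exact (ContinuousMap.dist_apply_le_dist _).trans_lt hdist

/-- Entire functions that are almost `0` to the left and almost `1` to the right of a vertical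
strip, inside a given disc. -/
theorem exists_entire_approx_step {d : ℝ} (hd : 0 < d) (C : ℝ) {ε : ℝ} (hε : 0 < ε) :
    ∃ φ : ℂ → ℂ, Differentiable ℂ φ ∧ ∀ z : ℂ, ‖z‖ ≤ C →
      (z.re ≤ -d → ‖φ z‖ < ε) ∧ (d ≤ z.re → ‖φ z - 1‖ < ε) := by
  obtain ⟨t, ht⟩ : ∃ t : ℝ, 1 + 2 / ε < Real.exp (t * d) ∧ 0 < t := by
    have h1 : Tendsto (fun t : ℝ => Real.exp (t * d)) atTop atTop :=
      Real.tendsto_exp_atTop.comp (tendsto_id.atTop_mul_const hd)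
    exact ((h1.eventually_gt_atTop _).and (eventually_gt_atTop 0)).exists
  obtain ⟨ht, ht0⟩ := ht
  let F : ℂ → ℂ := fun z => 1 + Complex.exp (-(t * z))
  have hF : Differentiable ℂ F := by fun_prop
  let K : Set ℂ := {z | ‖z‖ ≤ C} ∩ {z | d ≤ |z.re|}
  have hK : IsCompact K := by
    refine IsCompact.inter_right ?_ (isClosed_le continuous_const (by fun_prop))
    simpa [Metric.closedBall, dist_eq_norm] using isCompact_closedBall (0 : ℂ) C
  have hre (z : ℂ) : ‖Complex.exp (-(t * z))‖ = Real.exp (-(t * z.re)) := by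
    simp [Complex.norm_exp]
  have hzero : ∀ w, F w = 0 → ∀ z ∈ K, z.re ≠ w.re := by
    intro w hw z hz h
    have h1 : Complex.exp (-(t * w)) = -1 := by
      have : 1 + Complex.exp (-(t * w)) = 0 := hw
      linear_combination this
    have h2 := hre w
    rw [h1, norm_neg, norm_one, eq_comm, Real.exp_eq_one_iff, neg_eq_zero] at h2
    have h3 : w.re = 0 := (mul_eq_zero.mp h2).resolve_left ht0.ne'
    have h4 : d ≤ |z.re| := hz.2
    rw [h, h3, abs_zero] at h4
    linarith
  obtain ⟨φ, hφ, happ⟩ := exists_entire_approx_inv hK hF hzero (half_pos hε)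
  set Y := Real.exp (t * d) with hY
  have hY0 : 0 < 2 / ε := by positivity
  have hYinv : (Y - 1)⁻¹ < ε / 2 := by
    rw [inv_lt_comm₀ (by linarith) (by linarith), inv_div]
    linarith
  refine ⟨φ, hφ, fun z hz => ⟨fun hzd => ?_, fun hzd => ?_⟩⟩
  · have hE : Y ≤ ‖Complex.exp (-(t * z))‖ := by
      rw [hre, hY]
      exact Real.exp_le_exp.mpr (by nlinarith)
    have h1 : Y - 1 ≤ ‖F z‖ := by
      have := norm_sub_norm_le (Complex.exp (-(t * z))) (-1)
      rw [norm_neg, norm_one, sub_neg_eq_add, add_comm (Complex.exp _)] at this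
      change _ ≤ ‖1 + Complex.exp (-(t * z))‖
      linarith
    have h2 : ‖(F z)⁻¹‖ ≤ (Y - 1)⁻¹ := by
      rw [norm_inv]
      exact inv_anti₀ (by linarith) h1
    have h3 := happ z ⟨hz, by change d ≤ |z.re|; rw [abs_of_nonpos (by linarith)]; linarith⟩
    calc ‖φ z‖ = ‖(φ z - (F z)⁻¹) + (F z)⁻¹‖ := by rw [sub_add_cancel]
      _ ≤ ‖φ z - (F z)⁻¹‖ + ‖(F z)⁻¹‖ := norm_add_le _ _
      _ < ε := by linarith
  · have hE : ‖Complex.exp (-(t * z))‖ ≤ Y⁻¹ := by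
      rw [hre, hY, ← Real.exp_neg]
      exact Real.exp_le_exp.mpr (by nlinarith)
    have h1 : 1 - Y⁻¹ ≤ ‖F z‖ := by
      have := norm_sub_norm_le (1 : ℂ) (-Complex.exp (-(t * z)))
      rw [norm_neg, norm_one, sub_neg_eq_add] at this
      change _ ≤ ‖1 + Complex.exp (-(t * z))‖
      linarith
    have hYpos : 0 < Y := Real.exp_pos _
    have hY1 : 0 < 1 - Y⁻¹ := by
      have : Y⁻¹ < 1 := inv_lt_one_of_one_lt₀ (by linarith)
      linarith
    have hF0 : F z ≠ 0 := by
      intro h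
      rw [h, norm_zero] at h1
      linarith
    have h2 : ‖(F z)⁻¹ - 1‖ ≤ (Y - 1)⁻¹ := by
      have : (F z)⁻¹ - 1 = - Complex.exp (-(t * z)) / F z := by
        rw [eq_div_iff hF0, sub_mul, inv_mul_cancel₀ hF0]
        change 1 - 1 * (1 + Complex.exp (-(t * z))) = _
        ring
      rw [this, norm_div, norm_neg]
      calc _ ≤ Y⁻¹ / (1 - Y⁻¹) := by gcongr
        _ = (Y - 1)⁻¹ := by
          have : Y - 1 ≠ 0 := by linarith
          field_simp
    have h3 := happ z ⟨hz, by change d ≤ |z.re|; rw [abs_of_nonneg (by linarith)]; linarith⟩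
    calc ‖φ z - 1‖ = ‖(φ z - (F z)⁻¹) + ((F z)⁻¹ - 1)‖ := by rw [sub_add_sub_cancel]
      _ ≤ ‖φ z - (F z)⁻¹‖ + ‖(F z)⁻¹ - 1‖ := norm_add_le _ _
      _ < ε := by linarith

/-- The values prescribed by `G` (a set of pairs `(z, y)`) can be attained up to a uniformly small
error by an entire function. -/
def EntireApprox (G : Set (ℂ × ℂ)) : Prop :=
  ∀ ε > 0, ∃ F : ℂ → ℂ, Differentiable ℂ F ∧ ∀ x ∈ G, ‖F x.1 - x.2‖ < ε

/-- Prescriptions supported in two bounded sets that are separated by a strip can be combined. -/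
theorem EntireApprox.union {G₁ G₂ : Set (ℂ × ℂ)} (h₁ : EntireApprox G₁) (h₂ : EntireApprox G₂)
    (c : ℂ) {γ₁ γ₂ C : ℝ} (hγ : γ₁ < γ₂)
    (hG₁ : ∀ x ∈ G₁, ‖x.1‖ ≤ C ∧ (c * x.1).re ≤ γ₁)
    (hG₂ : ∀ x ∈ G₂, ‖x.1‖ ≤ C ∧ γ₂ ≤ (c * x.1).re) : EntireApprox (G₁ ∪ G₂) := by
  intro ε hε
  obtain ⟨F₁, hF₁, h₁⟩ := h₁ (ε / 2) (half_pos hε)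
  obtain ⟨F₂, hF₂, h₂⟩ := h₂ (ε / 2) (half_pos hε)
  obtain ⟨M, hM⟩ := (isCompact_closedBall (0 : ℂ) C).exists_bound_of_continuousOn
    (hF₂.sub hF₁).continuous.continuousOn
  set m : ℝ := (γ₁ + γ₂) / 2 with hm
  set M' : ℝ := |M| + 1 with hM'
  have hM'0 : 0 < M' := by positivity
  have hMM' : M < M' := by
    have := le_abs_self M
    linarith
  obtain ⟨φ, hφ, happ⟩ := exists_entire_approx_step (d := (γ₂ - γ₁) / 2) (by linarith)
    (‖c‖ * C + |m|) (ε := ε / (2 * M')) (by positivity)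
  have hbound {z : ℂ} (hz : ‖z‖ ≤ C) : ‖c * z - m‖ ≤ ‖c‖ * C + |m| := by
    refine (norm_sub_le _ _).trans ?_
    rw [norm_mul, Complex.norm_real, Real.norm_eq_abs]
    gcongr
  have hre (z : ℂ) : (c * z - m).re = (c * z).re - m := by simp
  have hmul {z q : ℂ} (hz : ‖z‖ ≤ C) (hq : ‖q‖ < ε / (2 * M')) :
      ‖q * (F₂ z - F₁ z)‖ ≤ ε / 2 := by
    have h3 : ‖F₂ z - F₁ z‖ ≤ M := hM z (by simpa using hz)
    rw [norm_mul]
    calc _ ≤ ε / (2 * M') * M' := by gcongr; exact h3.trans hMM'.le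
      _ = ε / 2 := by field_simp
  refine ⟨fun z => F₁ z + φ (c * z - m) * (F₂ z - F₁ z), ?_, ?_⟩
  · exact hF₁.add ((hφ.comp (by fun_prop)).mul (hF₂.sub hF₁))
  · rintro x (hx | hx)
    · obtain ⟨hxC, hxγ⟩ := hG₁ x hx
      have h3 := (happ (c * x.1 - m) (hbound hxC)).1 (by rw [hre, hm]; linarith)
      calc _ = ‖(F₁ x.1 - x.2) + φ (c * x.1 - m) * (F₂ x.1 - F₁ x.1)‖ := by ring_nf
        _ ≤ ‖F₁ x.1 - x.2‖ + ‖φ (c * x.1 - m) * (F₂ x.1 - F₁ x.1)‖ := norm_add_le _ _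
        _ < ε := by linarith [h₁ x hx, hmul hxC h3]
    · obtain ⟨hxC, hxγ⟩ := hG₂ x hx
      have h3 := (happ (c * x.1 - m) (hbound hxC)).2 (by rw [hre, hm]; linarith)
      calc _ = ‖(F₂ x.1 - x.2) + (φ (c * x.1 - m) - 1) * (F₂ x.1 - F₁ x.1)‖ := by ring_nf
        _ ≤ ‖F₂ x.1 - x.2‖ + ‖(φ (c * x.1 - m) - 1) * (F₂ x.1 - F₁ x.1)‖ := norm_add_le _ _
        _ < ε := by linarith [h₂ x hx, hmul hxC h3]

theorem entireApprox_empty : EntireApprox ∅ :=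
  fun _ _ => ⟨0, differentiable_const 0, by simp⟩

theorem Differentiable.entireApprox {F : ℂ → ℂ} (hF : Differentiable ℂ F) {G : Set (ℂ × ℂ)}
    (hG : ∀ x ∈ G, x.2 = F x.1) : EntireApprox G :=
  fun ε hε => ⟨F, hF, fun x hx => by simpa [hG x hx] using hε⟩

/-- Prescriptions supported in pairwise disjoint parallel strips can be combined. -/
theorem EntireApprox.biUnion_strips {G : ℤ → Set (ℂ × ℂ)} {s : Finset ℤ} (c : ℂ) {b h r C : ℝ}
    (hr : 0 ≤ r) (hrh : 2 * r < h) (hG : ∀ i ∈ s, EntireApprox (G i))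
    (hC : ∀ i ∈ s, ∀ x ∈ G i, ‖x.1‖ ≤ C ∧ |(c * x.1).re - (b + h * i)| ≤ r) :
    EntireApprox (⋃ i ∈ s, G i) := by
  induction s using Finset.induction_on_max with
  | empty => simpa using entireApprox_empty
  | insert a s ha ih =>
    rw [Finset.set_biUnion_insert, union_comm]
    have ih := ih (fun i hi => hG i (Finset.mem_insert_of_mem hi))
      (fun i hi => hC i (Finset.mem_insert_of_mem hi))
    refine ih.union (hG a (Finset.mem_insert_self a s)) c (C := C)
      (γ₁ := b + h * (a - 1) + r) (γ₂ := b + h * a - r) (by linarith) ?_ ?_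
    · intro x hx
      obtain ⟨i, hi, hx⟩ := mem_iUnion₂.mp hx
      obtain ⟨hxC, hxi⟩ := hC i (Finset.mem_insert_of_mem hi) x hx
      have hia : (i : ℝ) ≤ a - 1 := by
        have := ha i hi
        exact_mod_cast Int.le_sub_one_of_lt this
      refine ⟨hxC, ?_⟩
      have := mul_le_mul_of_nonneg_left hia (by linarith : 0 ≤ h)
      linarith [(abs_le.mp hxi).2]
    · intro x hx
      obtain ⟨hxC, hxi⟩ := hC a (Finset.mem_insert_self a s) x hx
      exact ⟨hxC, by linarith [(abs_le.mp hxi).1]⟩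

/-- Prescriptions supported in discs centred at the points of a square grid can be combined. -/
theorem EntireApprox.biUnion_grid {G : ℤ → ℤ → Set (ℂ × ℂ)} {s t : Finset ℤ} (c : ℂ)
    (b : ℂ) {h r C : ℝ} (hr : 0 ≤ r) (hrh : 2 * r < h)
    (hG : ∀ i ∈ s, ∀ j ∈ t, EntireApprox (G i j))
    (hC : ∀ i ∈ s, ∀ j ∈ t, ∀ x ∈ G i j, ‖x.1‖ ≤ C ∧ ‖c⁻¹ * x.1 - (b + h * (i + j * I))‖ ≤ r) :
    EntireApprox (⋃ i ∈ s, ⋃ j ∈ t, G i j) := by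
  refine biUnion_strips c⁻¹ (b := b.re) (h := h) (r := r) (C := C) hr hrh (fun i hi => ?_) ?_
  · refine biUnion_strips (-I * c⁻¹) (b := b.im) (h := h) (r := r) (C := C) hr hrh (hG i hi)
      (fun j hj x hx => ?_)
    obtain ⟨hxC, hxr⟩ := hC i hi j hj x hx
    refine ⟨hxC, le_trans (le_of_eq ?_) ((abs_im_le_norm _).trans hxr)⟩
    rw [mul_assoc, neg_mul, neg_re, I_mul_re]
    simp
  · intro i hi x hx
    obtain ⟨j, hj, hx⟩ := mem_iUnion₂.mp hx
    obtain ⟨hxC, hxr⟩ := hC i hi j hj x hx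
    refine ⟨hxC, le_trans (le_of_eq ?_) ((abs_re_le_norm _).trans hxr)⟩
    simp

/-- Prescriptions supported in a disc around the origin and in discs that lie further and further
outside can be combined. -/
theorem EntireApprox.union_levels {G₀ : Set (ℂ × ℂ)} {G : ℕ → Set (ℂ × ℂ)} {c : ℕ → ℂ} {N : ℕ}
    {σ τ τ' R : ℝ} (hτ : τ' < τ) (h₀ : EntireApprox G₀) (hG : ∀ j < N, EntireApprox (G j))
    (hc : ∀ j < N, c j ≠ 0)
    (hR : ∀ x ∈ G₀, ‖x.1‖ ≤ R) (hRc : ∀ j < N, R ≤ τ' * ‖c j‖)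
    (hσ : ∀ i < N, ∀ x ∈ G i, ‖x.1‖ ≤ σ * ‖c i‖ ∧ τ ≤ ((c i)⁻¹ * x.1).re)
    (hlev : ∀ j < N, ∀ i < j, σ * ‖c i‖ ≤ τ' * ‖c j‖) :
    EntireApprox (G₀ ∪ ⋃ j ∈ Finset.range N, G j) := by
  induction N with
  | zero => simpa using h₀
  | succ n ih =>
    rw [Finset.range_add_one, Finset.set_biUnion_insert, union_comm (G n), ← union_assoc]
    have ih := ih (fun j hj => hG j (by omega)) (fun j hj => hc j (by omega))
      (fun j hj => hRc j (by omega)) (fun i hi => hσ i (by omega))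
      (fun j hj => hlev j (by omega))
    have hn := n.lt_succ_self
    have hprev : ∀ x ∈ G₀ ∪ ⋃ j ∈ Finset.range n, G j, ‖x.1‖ ≤ τ' * ‖c n‖ := by
      rintro x (hx | hx)
      · exact (hR x hx).trans (hRc n hn)
      · obtain ⟨i, hi, hx⟩ := mem_iUnion₂.mp hx
        have hi := Finset.mem_range.mp hi
        exact (hσ i (by omega) x hx).1.trans (hlev n hn i hi)
    refine ih.union (hG n hn) (c n)⁻¹ (C := max (τ' * ‖c n‖) (σ * ‖c n‖)) hτ
      (fun x hx => ⟨(hprev x hx).trans (le_max_left _ _), ?_⟩)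
      (fun x hx => ⟨(hσ n hn x hx).1.trans (le_max_right _ _), (hσ n hn x hx).2⟩)
    have hpos : 0 < ‖c n‖ := norm_pos_iff.mpr (hc n hn)
    refine (re_le_norm _).trans ?_
    rw [norm_mul, norm_inv, inv_mul_le_iff₀ hpos, mul_comm]
    exact hprev x hx

theorem Polynomial.tendsto_norm_eval_div_pow (p : Polynomial ℂ) (t : ℕ) :
    Tendsto (fun L : ℕ => ‖p.eval ((L * t : ℕ) : ℂ)‖ / (L : ℝ) ^ p.natDegree) atTop
      (𝓝 (‖p.leadingCoeff‖ * (t : ℝ) ^ p.natDegree)) := by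
  set d := p.natDegree with hd
  have hterm : ∀ i ∈ Finset.range d, Tendsto
      (fun L : ℕ => p.coeff i * (t : ℂ) ^ i * (((L : ℝ) ^ i / (L : ℝ) ^ d : ℝ) : ℂ)) atTop
      (𝓝 0) := by
    intro i hi
    have h1 := (tendsto_pow_div_pow_atTop_zero (𝕜 := ℝ) (Finset.mem_range.mp hi)).comp
      tendsto_natCast_atTop_atTop
    have h2 := ((continuous_ofReal.tendsto 0).comp h1).const_mul (p.coeff i * (t : ℂ) ^ i)
    simpa using h2
  have hsum := tendsto_finsetSum _ hterm
  have hlim := (hsum.add_const (p.leadingCoeff * (t : ℂ) ^ d)).norm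
  rw [Finset.sum_const_zero, zero_add, norm_mul, norm_pow, Complex.norm_natCast] at hlim
  refine hlim.congr' ?_
  filter_upwards [eventually_gt_atTop 0] with L hL
  have hL' : (L : ℂ) ≠ 0 := by exact_mod_cast hL.ne'
  have key : ∑ i ∈ Finset.range d,
      p.coeff i * (t : ℂ) ^ i * (((L : ℝ) ^ i / (L : ℝ) ^ d : ℝ) : ℂ) +
      p.leadingCoeff * (t : ℂ) ^ d = p.eval ((L * t : ℕ) : ℂ) / (L : ℂ) ^ d := by
    rw [eval_eq_sum_range, ← hd, Finset.sum_range_succ, add_div, Finset.sum_div]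
    congr 1
    · refine Finset.sum_congr rfl fun i _ => ?_
      push_cast
      ring
    · rw [leadingCoeff, ← hd]
      push_cast
      field_simp
      ring
  rw [key, norm_div, norm_pow, Complex.norm_natCast]

/-- Along a suitable arithmetic progression, the values of a nonconstant polynomial have
comparable moduli which grow geometrically. -/
theorem Polynomial.exists_geometric_levels {p : Polynomial ℂ} (hdeg : 0 < p.natDegree) {a : ℂ}
    (ha : a ≠ 0) (N : ℕ) :
    ∃ q : ℝ, 1 < q ∧ ∀ M : ℝ, ∃ (n : ℕ → ℕ) (S : ℝ), M ≤ S ∧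
      (∀ j < N, S ≤ ‖p.eval ((n j + 1 : ℕ) : ℂ) * a‖ ∧
        ‖p.eval ((n j + 1 : ℕ) : ℂ) * a‖ ≤ 8 * S) ∧
      ∀ j < N, ∀ i < j, q * ‖p.eval ((n i + 1 : ℕ) : ℂ) * a‖ ≤
        ‖p.eval ((n j + 1 : ℕ) : ℂ) * a‖ := by
  set d := p.natDegree with hd
  set T : ℕ := d * N + 1 with hT
  set A : ℝ := ‖p.leadingCoeff‖ with hA
  have hA0 : 0 < A := by
    rw [hA, norm_pos_iff, Ne, leadingCoeff_eq_zero]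
    exact fun h => hdeg.ne' (by rw [hd, h, natDegree_zero])
  have ha0 : 0 < ‖a‖ := norm_pos_iff.mpr ha
  have hT0 : (0 : ℝ) < T := by positivity
  set q : ℝ := 1 + 1 / (T + N) with hq
  let Y (j L : ℕ) : ℝ := ‖p.eval ((L * (T + j) : ℕ) : ℂ)‖ / (L : ℝ) ^ d
  have hY (j : ℕ) : Tendsto (Y j) atTop (𝓝 (A * ((T + j : ℕ) : ℝ) ^ d)) :=
    p.tendsto_norm_eval_div_pow (T + j)
  have hlow : ∀ j ∈ Finset.range N, ∀ᶠ L in atTop, A * T ^ d / 2 < Y j L := by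
    intro j _
    refine (hY j).eventually_const_lt ?_
    have h1 : A * (T : ℝ) ^ d ≤ A * ((T + j : ℕ) : ℝ) ^ d := by
      gcongr
      exact Nat.le_add_right T j
    have h2 : 0 < A * (T : ℝ) ^ d := by positivity
    linarith
  have hupp : ∀ j ∈ Finset.range N, ∀ᶠ L in atTop, Y j L < 4 * (A * T ^ d) := by
    intro j hj
    refine (hY j).eventually_lt_const ?_
    have h1 : ((T + j : ℕ) : ℝ) = T * (1 + j / T) := by
      push_cast
      field_simp
    have h2 : (1 + j / T : ℝ) ^ d ≤ Real.exp 1 := by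
      calc (1 + j / T : ℝ) ^ d ≤ Real.exp (j / T) ^ d := by
            gcongr
            rw [add_comm]
            exact Real.add_one_le_exp _
        _ = Real.exp (d * (j / T)) := by rw [← Real.exp_nat_mul]
        _ ≤ Real.exp 1 := by
            rw [Real.exp_le_exp, ← mul_div_assoc, div_le_one hT0]
            have : d * j ≤ T := by
              have := Nat.mul_le_mul_left d (Finset.mem_range.mp hj).le
              omega
            exact_mod_cast this
    have h3 := Real.exp_one_lt_d9
    have h4 : 0 < A * (T : ℝ) ^ d := by positivity
    rw [h1, mul_pow]
    nlinarith
  have hrat : ∀ j ∈ Finset.range N, ∀ i ∈ Finset.range j, ∀ᶠ L in atTop, q * Y i L < Y j L := by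
    intro j hj i hi
    refine ((hY i).const_mul q).eventually_lt (hY j) ?_
    have hi := Finset.mem_range.mp hi
    have hj := Finset.mem_range.mp hj
    have h1 : q * ((T + i : ℕ) : ℝ) < ((T + j : ℕ) : ℝ) := by
      have h2 : ((T + i : ℕ) : ℝ) < T + N := by
        exact_mod_cast Nat.add_lt_add_left (hi.trans hj) T
      have h3 : ((T + i : ℕ) : ℝ) + 1 ≤ ((T + j : ℕ) : ℝ) := by
        exact_mod_cast Nat.add_lt_add_left hi T
      have h4 : 1 / ((T : ℝ) + N) * ((T + i : ℕ) : ℝ) < 1 := by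
        rw [one_div_mul_eq_div, div_lt_one (by positivity)]
        exact h2
      rw [hq]
      linarith
    obtain ⟨e, he⟩ : ∃ e, d = e + 1 := ⟨d - 1, by omega⟩
    have h5 : ((T + i : ℕ) : ℝ) ^ e ≤ ((T + j : ℕ) : ℝ) ^ e := by
      gcongr
    have h6 : (0 : ℝ) < ((T + i : ℕ) : ℝ) := by positivity
    rw [he, pow_succ, pow_succ]
    calc q * (A * (((T + i : ℕ) : ℝ) ^ e * ((T + i : ℕ) : ℝ)))
        = A * (((T + i : ℕ) : ℝ) ^ e * (q * ((T + i : ℕ) : ℝ))) := by ring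
      _ < A * (((T + i : ℕ) : ℝ) ^ e * ((T + j : ℕ) : ℝ)) := by gcongr
      _ ≤ A * (((T + j : ℕ) : ℝ) ^ e * ((T + j : ℕ) : ℝ)) := by gcongr
  refine ⟨q, by rw [hq]; simp; positivity, fun M => ?_⟩
  have hM : Tendsto (fun L : ℕ => A * T ^ d / 2 * ((L : ℝ) ^ d * ‖a‖)) atTop atTop :=
    (((tendsto_pow_atTop hdeg.ne').comp tendsto_natCast_atTop_atTop).atTop_mul_const
      ha0).const_mul_atTop (by positivity)
  have hev := ((Finset.range N).eventually_all.mpr hlow).and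
    (((Finset.range N).eventually_all.mpr hupp).and
      (((Finset.range N).eventually_all.mpr fun j hj =>
        (Finset.range j).eventually_all.mpr (hrat j hj)).and
          ((hM.eventually_ge_atTop M).and (eventually_gt_atTop 0))))
  obtain ⟨L, h1, h2, h3, h4, h5⟩ := hev.exists
  have hL : 0 < (L : ℝ) ^ d * ‖a‖ := by positivity
  have hidx (j : ℕ) : L * (T + j) - 1 + 1 = L * (T + j) :=
    Nat.sub_add_cancel (Nat.mul_pos h5 (by omega))
  have hval (j : ℕ) : ‖p.eval ((L * (T + j) - 1 + 1 : ℕ) : ℂ) * a‖ =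
      Y j L * ((L : ℝ) ^ d * ‖a‖) := by
    rw [hidx, norm_mul]
    have : (L : ℝ) ^ d ≠ 0 := by positivity
    simp only [Y]
    field_simp
  refine ⟨fun j => L * (T + j) - 1, A * T ^ d / 2 * ((L : ℝ) ^ d * ‖a‖), h4, fun j hj => ?_,
    fun j hj i hi => ?_⟩
  · rw [hval]
    refine ⟨by have := h1 j (Finset.mem_range.mpr hj); gcongr, ?_⟩
    calc _ ≤ 4 * (A * T ^ d) * ((L : ℝ) ^ d * ‖a‖) := by
          have := h2 j (Finset.mem_range.mpr hj)
          gcongr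
      _ = _ := by ring
  · rw [hval, hval, ← mul_assoc]
    have := h3 j (Finset.mem_range.mpr hj) i (Finset.mem_range.mpr hi)
    gcongr

/-- A real number is close to a point of one of `m` translates of the lattice `h ℤ`. -/
theorem exists_int_nat_abs_sub_le (x : ℝ) {h : ℝ} (hh : 0 < h) {m : ℕ} (hm : 0 < m) :
    ∃ (i : ℤ) (l : ℕ), l < m ∧ |x - (h * i + h / m * l)| ≤ h / m ∧ |h * i| ≤ |x| + h := by
  have hm' : (0 : ℝ) < m := by exact_mod_cast hm
  have hx : x = h * (x / h) := by field_simp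
  have h0 := Int.fract_nonneg (x / h)
  have h1 := Int.fract_lt_one (x / h)
  have h2 := Int.floor_add_fract (x / h)
  set u := Int.fract (x / h)
  have h3 : h * ⌊x / h⌋ = x - h * u := by
    rw [← eq_sub_iff_add_eq] at h2
    rw [h2, mul_sub, ← hx]
  refine ⟨⌊x / h⌋, ⌊m * u⌋₊, ?_, ?_, ?_⟩
  · rw [Nat.floor_lt (by positivity)]
    nlinarith
  · have h4 := Nat.floor_le (show 0 ≤ m * u by positivity)
    have h5 := Nat.lt_floor_add_one (m * u)
    have h6 : x - (h * ⌊x / h⌋ + h / m * ⌊m * u⌋₊) = h / m * (m * u - ⌊m * u⌋₊) := by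
      rw [h3]
      field_simp
      ring
    rw [h6, abs_of_nonneg (mul_nonneg (by positivity) (by linarith))]
    exact mul_le_of_le_one_right (by positivity) (by linarith)
  · rw [h3]
    refine (abs_sub _ _).trans ?_
    rw [abs_of_nonneg (show 0 ≤ h * u by positivity)]
    nlinarith

theorem Complex.norm_add_mul_I_le (x y : ℝ) : ‖(x : ℂ) + y * I‖ ≤ |x| + |y| := by
  simpa using norm_le_abs_re_add_abs_im ((x : ℂ) + y * I)

/-- For parameters `a` in a small disc, an entire function that approximates `g` on a given disc can
have, for each of these `a`, a translate by some `p (n + 1) * a` that approximates `h`. -/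
theorem exists_entire_approx_translates {p : Polynomial ℂ} (hdeg : 0 < p.natDegree) {h : ℂ → ℂ}
    (hh : Differentiable ℂ h) {k ε : ℝ} (hk : 0 ≤ k) (hε : 0 < ε) {a₀ : ℂ} (ha₀ : a₀ ≠ 0) :
    ∃ η : ℝ, 0 < η ∧ η < 1 ∧ ∀ g : ℂ → ℂ, Differentiable ℂ g → ∀ R ε' : ℝ, 0 < ε' →
      ∃ f : ℂ → ℂ, Differentiable ℂ f ∧ (∀ z, ‖z‖ ≤ R → ‖f z - g z‖ < ε') ∧
        ∀ a, ‖a - a₀‖ ≤ η * ‖a₀‖ →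
          ∃ n : ℕ, ∀ z, ‖z‖ ≤ k → ‖f (z + p.eval ((n + 1 : ℕ) : ℂ) * a) - h z‖ < ε := by
  obtain ⟨δ, hδ0, hδ1, hδ⟩ : ∃ δ > 0, δ ≤ 1 ∧ ∀ z v : ℂ, ‖z‖ ≤ k → ‖v‖ < δ →
      ‖h (z + v) - h z‖ < ε / 2 := by
    have huc := (isCompact_closedBall (0 : ℂ) (k + 1)).uniformContinuousOn_of_continuous
      hh.continuous.continuousOn
    obtain ⟨δ, hδ0, hδ⟩ := Metric.uniformContinuousOn_iff.mp huc (ε / 2) (half_pos hε)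
    refine ⟨min δ 1, lt_min hδ0 one_pos, min_le_right _ _, fun z v hz hv => ?_⟩
    rw [← dist_eq_norm]
    refine hδ _ ?_ _ ?_ ?_
    · rw [mem_closedBall_zero_iff]
      exact (norm_add_le _ _).trans (add_le_add hz (hv.le.trans (min_le_right _ _)))
    · rw [mem_closedBall_zero_iff]
      linarith
    · rw [dist_eq_norm, add_sub_cancel_left]
      exact hv.trans_le (min_le_left _ _)
  obtain ⟨m, hm⟩ := exists_nat_gt (32 * (k + 2) / δ)
  have hm0' : (0 : ℝ) < m := lt_of_le_of_lt (by positivity) hm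
  have hm0 : 0 < m := by exact_mod_cast hm0'
  obtain ⟨q, hq, hlevels⟩ := exists_geometric_levels hdeg ha₀ (m * m)
  obtain ⟨η, hη0, hη1, hηq⟩ : ∃ η : ℝ, 0 < η ∧ η ≤ 1 / 24 ∧ (1 + 6 * η) / q < 1 - 6 * η := by
    refine ⟨min (1 / 24) ((q - 1) / (12 * (1 + q))), lt_min (by norm_num)
      (div_pos (by linarith) (by linarith)), min_le_left _ _, ?_⟩
    have h1 : min (1 / 24) ((q - 1) / (12 * (1 + q))) * (12 * (1 + q)) ≤ q - 1 := by
      rw [← le_div_iff₀ (by linarith)]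
      exact min_le_right _ _
    rw [div_lt_iff₀ (by linarith)]
    nlinarith
  refine ⟨η, hη0, by linarith, fun g hg R ε' hε' => ?_⟩
  obtain ⟨n, S, hS, hnS, hnq⟩ := hlevels (max (max (q * R) 1) (8 * (k + 2) / η))
  have hSR : q * R ≤ S := (le_max_left _ _).trans ((le_max_left _ _).trans hS)
  have hS0 : 0 < S := one_pos.trans_le ((le_max_right _ _).trans ((le_max_left _ _).trans hS))
  have hSη : 8 * (k + 2) / η ≤ S := (le_max_right _ _).trans hS
  set c : ℕ → ℂ := fun j => p.eval ((n j + 1 : ℕ) : ℂ) * a₀ with hc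
  have hcpos : ∀ j < m * m, 0 < ‖c j‖ := fun j hj => hS0.trans_le (hnS j hj).1
  set s : ℝ := 2 * (k + 2) / S with hs
  set r : ℝ := (k + 1) / S with hr
  have hs0 : 0 < s := by positivity
  have hr0 : 0 ≤ r := by positivity
  have hrs : 2 * r < s := by
    rw [hs, hr, ← mul_div_assoc]
    gcongr
    linarith
  have hsη : 4 * s ≤ η := by
    rw [div_le_iff₀ hη0] at hSη
    rw [hs, ← mul_div_assoc, div_le_iff₀ hS0]
    linarith
  have hmesh : 8 * S * (2 * (s / m)) < δ := by
    rw [div_lt_iff₀ hδ0] at hm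
    have : 8 * S * (2 * (s / m)) = 32 * (k + 2) / m := by
      rw [hs]
      field_simp
      ring
    rw [this, div_lt_iff₀ hm0']
    linarith
  -- base points and centres of the grids
  let b : ℕ → ℂ := fun j =>
    1 + (((s / m * (j % m : ℕ) : ℝ) : ℂ) + ((s / m * (j / m : ℕ) : ℝ) : ℂ) * I)
  let v : ℕ → ℤ → ℤ → ℂ := fun j α β => b j + s * (α + β * I)
  let G : ℕ → ℤ → ℤ → Set (ℂ × ℂ) := fun j α β =>
    {x | ‖(c j)⁻¹ * x.1 - v j α β‖ ≤ r ∧ x.2 = h (x.1 - c j * v j α β)}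
  let A : ℤ := ⌈(η + s) / s⌉
  let t : Finset ℤ := Finset.Icc (-A) A
  have ht : ∀ i ∈ t, |s * i| ≤ η + 2 * s := by
    intro i hi
    have hi' := abs_le.mpr (Finset.mem_Icc.mp hi)
    have h1 : (|i| : ℝ) ≤ A := by exact_mod_cast hi'
    have h2 : (A : ℝ) < (η + s) / s + 1 := Int.ceil_lt_add_one _
    rw [abs_mul, abs_of_pos hs0]
    calc s * |(i : ℝ)| ≤ s * ((η + s) / s + 1) := by gcongr; linarith
      _ = η + 2 * s := by field_simp; ring
  have ht' : ∀ i : ℤ, |s * i| ≤ η + s → i ∈ t := by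
    intro i hi
    rw [abs_mul, abs_of_pos hs0, mul_comm, ← le_div_iff₀ hs0] at hi
    have h1 : (|i| : ℝ) ≤ A := hi.trans (Int.le_ceil _)
    exact Finset.mem_Icc.mpr (abs_le.mp (by exact_mod_cast h1))
  have hshift : ∀ l < m, |s / m * (l : ℕ)| ≤ s := by
    intro l hl
    have hl' : (l : ℝ) ≤ m := by exact_mod_cast hl.le
    rw [abs_of_nonneg (by positivity)]
    calc s / m * l ≤ s / m * m := by gcongr
      _ = s := by field_simp
  have hv1 : ∀ j < m * m, ∀ α ∈ t, ∀ β ∈ t, ‖v j α β - 1‖ ≤ 2 * η + 6 * s := by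
    intro j hj α hα β hβ
    have h1 : v j α β - 1 =
        (((s / m * (j % m : ℕ) : ℝ) : ℂ) + ((s / m * (j / m : ℕ) : ℝ) : ℂ) * I) +
          (((s * α : ℝ) : ℂ) + ((s * β : ℝ) : ℂ) * I) := by
      simp only [v, b]
      push_cast
      ring
    rw [h1]
    have h2 := (norm_add_mul_I_le (s / m * (j % m : ℕ)) (s / m * (j / m : ℕ))).trans
      (add_le_add (hshift _ (Nat.mod_lt j hm0)) (hshift _ (Nat.div_lt_of_lt_mul hj)))
    have h3 := (norm_add_mul_I_le (s * α) (s * β)).trans (add_le_add (ht α hα) (ht β hβ))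
    refine (norm_add_le _ _).trans ?_
    linarith
  have hdisc : ∀ j < m * m, ∀ α ∈ t, ∀ β ∈ t, ∀ x ∈ G j α β, ‖(c j)⁻¹ * x.1 - 1‖ ≤ 6 * η := by
    intro j hj α hα β hβ x hx
    have h1 := norm_add_le ((c j)⁻¹ * x.1 - v j α β) (v j α β - 1)
    rw [sub_add_sub_cancel] at h1
    linarith [hv1 j hj α hα β hβ, hx.1]
  have hdisc_norm : ∀ j < m * m, ∀ α ∈ t, ∀ β ∈ t, ∀ x ∈ G j α β,
      ‖x.1‖ ≤ (1 + 6 * η) * ‖c j‖ := by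
    intro j hj α hα β hβ x hx
    have h1 := norm_add_le ((c j)⁻¹ * x.1 - 1) 1
    rw [sub_add_cancel, norm_one, norm_mul, norm_inv, inv_mul_eq_div] at h1
    rw [← div_le_iff₀ (hcpos j hj)]
    linarith [hdisc j hj α hα β hβ x hx]
  have happrox : EntireApprox ({x | ‖x.1‖ ≤ R ∧ x.2 = g x.1} ∪
      ⋃ j ∈ Finset.range (m * m), ⋃ α ∈ t, ⋃ β ∈ t, G j α β) := by
    refine EntireApprox.union_levels (c := c) (σ := 1 + 6 * η) (R := R) hηq
      (hg.entireApprox fun x hx => hx.2) (fun j hj => ?_)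
      (fun j hj => norm_pos_iff.mp (hcpos j hj)) (fun x hx => hx.1) (fun j hj => ?_)
      (fun j hj x hx => ?_) (fun j hj i hi => ?_)
    · refine EntireApprox.biUnion_grid (c j) (b j) hr0 hrs
        (C := (1 + 6 * η) * ‖c j‖) (fun α _ β _ => ?_)
        (fun α hα β hβ x hx => ⟨hdisc_norm j hj α hα β hβ x hx, hx.1⟩)
      exact (hh.comp (differentiable_id.sub_const (c j * v j α β))).entireApprox fun x hx => hx.2
    · have h1 := hSR.trans (hnS j hj).1
      rw [div_mul_eq_mul_div, le_div_iff₀ (by linarith), mul_comm]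
      refine h1.trans (le_mul_of_one_le_left (norm_nonneg _) (by linarith))
    · obtain ⟨α, hα, hx⟩ := mem_iUnion₂.mp hx
      obtain ⟨β, hβ, hx⟩ := mem_iUnion₂.mp hx
      refine ⟨hdisc_norm j hj α hα β hβ x hx, ?_⟩
      have h1 := (abs_re_le_norm _).trans (hdisc j hj α hα β hβ x hx)
      rw [sub_re, one_re] at h1
      linarith [(abs_le.mp h1).1]
    · rw [div_mul_eq_mul_div, le_div_iff₀ (by linarith), mul_assoc, mul_comm _ q]
      gcongr
      exact hnq j hj i hi
  obtain ⟨f, hf, hfG⟩ := happrox (min ε' (ε / 2)) (lt_min hε' (half_pos hε))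
  refine ⟨f, hf, fun z hz => ?_, fun a ha => ?_⟩
  · exact (hfG (z, g z) (Or.inl ⟨hz, rfl⟩)).trans_le (min_le_left _ _)
  have ha₀' : 0 < ‖a₀‖ := norm_pos_iff.mpr ha₀
  set u : ℂ := a / a₀ - 1 with hu
  have hau : a = a₀ * (1 + u) := by
    rw [hu]
    field_simp
    ring
  have huη : ‖u‖ ≤ η := by
    have h1 : a - a₀ = u * a₀ := by rw [hau]; ring
    rw [h1, norm_mul] at ha
    exact le_of_mul_le_mul_right ha ha₀'
  obtain ⟨α, l₁, hl₁, hα, hα'⟩ := exists_int_nat_abs_sub_le u.re hs0 hm0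
  obtain ⟨β, l₂, hl₂, hβ, hβ'⟩ := exists_int_nat_abs_sub_le u.im hs0 hm0
  have hαt : α ∈ t := ht' α (by linarith [abs_re_le_norm u])
  have hβt : β ∈ t := ht' β (by linarith [abs_im_le_norm u])
  set j : ℕ := l₁ + m * l₂ with hj
  have hjm : j < m * m := by
    calc l₁ + m * l₂ < m + m * l₂ := by omega
      _ = m * (l₂ + 1) := by ring
      _ ≤ m * m := Nat.mul_le_mul_left m hl₂
  have hj₁ : j % m = l₁ := by rw [hj, Nat.add_mul_mod_self_left, Nat.mod_eq_of_lt hl₁]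
  have hj₂ : j / m = l₂ := by
    rw [hj, Nat.add_mul_div_left _ _ hm0, Nat.div_eq_of_lt hl₁, zero_add]
  have hclose : ‖1 + u - v j α β‖ ≤ 2 * (s / m) := by
    have h1 : 1 + u - v j α β = ((u.re - (s * α + s / m * l₁) : ℝ) : ℂ) +
        ((u.im - (s * β + s / m * l₂) : ℝ) : ℂ) * I := by
      simp only [v, b, hj₁, hj₂]
      nth_rewrite 1 [← re_add_im u]
      push_cast
      ring
    rw [h1]
    refine (norm_add_mul_I_le _ _).trans ?_
    linarith
  have hshiftδ : ‖c j * (1 + u - v j α β)‖ < δ := by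
    rw [norm_mul]
    refine lt_of_le_of_lt ?_ hmesh
    gcongr
    exact (hnS j hjm).2
  refine ⟨n j, fun z hz => ?_⟩
  set y : ℂ := z + p.eval ((n j + 1 : ℕ) : ℂ) * a with hy
  have hyc : y - c j * v j α β = z + c j * (1 + u - v j α β) := by
    rw [hy, hau, hc]
    ring
  have hcj : c j ≠ 0 := norm_pos_iff.mp (hcpos j hjm)
  have hyG : (y, h (y - c j * v j α β)) ∈ G j α β := by
    refine ⟨?_, rfl⟩
    have h1 : (c j)⁻¹ * y - v j α β = (c j)⁻¹ * (y - c j * v j α β) := by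
      field_simp
    change ‖(c j)⁻¹ * y - v j α β‖ ≤ r
    rw [h1, hyc, norm_mul, norm_inv, inv_mul_eq_div, hr]
    have h2 := norm_add_le z (c j * (1 + u - v j α β))
    have h3 := (hnS j hjm).1
    gcongr
    linarith
  have h1 := (hfG _ (Or.inr (mem_iUnion₂.mpr ⟨j, Finset.mem_range.mpr hjm,
    mem_iUnion₂.mpr ⟨α, hαt, mem_iUnion₂.mpr ⟨β, hβt, hyG⟩⟩⟩))).trans_le (min_le_right _ _)
  have h2 := hδ z _ hz hshiftδ
  rw [← hyc] at h2
  calc ‖f y - h z‖ = ‖(f y - h (y - c j * v j α β)) + (h (y - c j * v j α β) - h z)‖ := by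
        rw [sub_add_sub_cancel]
    _ ≤ _ := norm_add_le _ _
    _ < ε := by
        change ‖f y - h (y - c j * v j α β)‖ < ε / 2 at h1
        linarith

instance inst_s2 : BaireSpace Hc :=
  have : TopologicalSpace.IsCompletelyPseudoMetrizableSpace Hc :=
    isClosed_setOf_differentiable.isClosedEmbedding_subtypeVal.IsCompletelyPseudoMetrizableSpace
  inferInstance

instance inst_s2_2 : SecondCountableTopology Hc :=
  TopologicalSpace.Subtype.secondCountableTopology {f : C(ℂ, ℂ) | Differentiable ℂ (f : ℂ → ℂ)}

/-- Uniform closeness on large discs gives a basis of neighbourhoods in `H(ℂ)`. -/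
theorem Hc.exists_of_mem_nhds {g : Hc} {V : Set Hc} (hV : V ∈ 𝓝 g) :
    ∃ k ε : ℝ, 0 ≤ k ∧ 0 < ε ∧ ∀ f : Hc, (∀ z, ‖z‖ ≤ k → ‖f.1 z - g.1 z‖ < ε) → f ∈ V := by
  obtain ⟨W, hW, hWV⟩ := mem_nhds_subtype _ _ _ |>.mp hV
  obtain ⟨D, hD, hDW⟩ := UniformSpace.mem_nhds_iff.mp hW
  obtain ⟨K, U, hK, hU, hKU⟩ := (ContinuousMap.mem_compactConvergence_entourage_iff D).mp hD
  obtain ⟨ε, hε, hεU⟩ := Metric.mem_uniformity_dist.mp hU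
  obtain ⟨k, hk⟩ := hK.isBounded.exists_norm_le
  refine ⟨|k|, ε, abs_nonneg k, hε, fun f hf => hWV (hDW (hKU ?_))⟩
  intro z hz
  refine hεU ?_
  rw [dist_comm, dist_eq_norm]
  exact hf z ((hk z hz).trans (le_abs_self k))

theorem continuous_translateH : Continuous fun x : Hc × ℂ => translateH x.1 x.2 := by
  refine Continuous.subtype_mk (ContinuousMap.continuous_of_continuous_uncurry _ ?_) _
  change Continuous fun x : (Hc × ℂ) × ℂ => x.1.1.1 (x.2 + x.1.2)
  fun_prop

/-- The entire functions that have, for every parameter in `K`, a translate in `V`. -/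
def translatesMeet (lam : ℕ → ℂ) (K : Set ℂ) (V : Set Hc) : Set Hc :=
  {f | ∀ a ∈ K, ∃ n, translateH f (lam n * a) ∈ V}

theorem isOpen_translatesMeet (lam : ℕ → ℂ) {K : Set ℂ} (hK : IsCompact K) {V : Set Hc}
    (hV : IsOpen V) : IsOpen (translatesMeet lam K V) := by
  have hW : IsOpen {x : Hc × ℂ | ∃ n, translateH x.1 (lam n * x.2) ∈ V} := by
    rw [ofPred_exists]
    refine isOpen_iUnion fun n => hV.preimage ?_
    exact continuous_translateH.comp (by fun_prop : Continuous fun x : Hc × ℂ => (x.1, lam n * x.2))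
  rw [isOpen_iff_mem_nhds]
  intro f hf
  exact hK.eventually_forall_of_forall_eventually fun a ha => hW.mem_nhds (hf a ha)

/-- Every nonzero parameter has a compact neighbourhood `K`, not containing `0`, for which
`translatesMeet lam K V` is dense, when `lam` is given by a nonconstant polynomial. -/
theorem exists_nhds_dense_translatesMeet {p : Polynomial ℂ} (hdeg : 0 < p.natDegree) {V : Set Hc}
    (hV : IsOpen V) (hVne : V.Nonempty) {a₀ : ℂ} (ha₀ : a₀ ≠ 0) :
    ∃ K ∈ 𝓝 a₀, IsCompact K ∧ (0 : ℂ) ∉ K ∧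
      Dense (translatesMeet (fun n : ℕ => p.eval (((n + 1 : ℕ) : ℂ))) K V) := by
  obtain ⟨h, hh⟩ := hVne
  obtain ⟨k, ε, hk, hε, hkV⟩ := Hc.exists_of_mem_nhds (hV.mem_nhds hh)
  obtain ⟨η, hη0, hη1, happ⟩ := exists_entire_approx_translates hdeg h.2 hk hε ha₀
  have ha₀' : 0 < ‖a₀‖ := norm_pos_iff.mpr ha₀
  refine ⟨Metric.closedBall a₀ (η * ‖a₀‖), Metric.closedBall_mem_nhds _ (by positivity),
    isCompact_closedBall _ _, ?_, ?_⟩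
  · rw [Metric.mem_closedBall, dist_zero_left, not_le]
    exact mul_lt_of_lt_one_left ha₀' hη1
  · intro g
    rw [mem_closure_iff_nhds]
    intro U hU
    obtain ⟨R, ε', -, hε', hRU⟩ := Hc.exists_of_mem_nhds hU
    obtain ⟨f, hf, hfg, hfh⟩ := happ g.1 g.2 R ε' hε'
    refine ⟨⟨⟨f, hf.continuous⟩, hf⟩, hRU _ hfg, fun a ha => ?_⟩
    obtain ⟨n, hn⟩ := hfh a (by rwa [Metric.mem_closedBall, dist_eq_norm] at ha)
    exact ⟨n, hkV _ hn⟩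

/-- The common hypercyclic functions form a countable intersection of dense open sets. -/
theorem exists_countable_iInter_HC_eq {p : Polynomial ℂ} (hdeg : 0 < p.natDegree) :
    ∃ 𝒮 : Set (Set Hc), 𝒮.Countable ∧ (∀ E ∈ 𝒮, IsOpen E ∧ Dense E) ∧
      ⋂ a ∈ {a : ℂ | a ≠ 0}, HC (fun n : ℕ => p.eval (((n + 1 : ℕ) : ℂ))) a = ⋂₀ 𝒮 := by
  set lam : ℕ → ℂ := fun n : ℕ => p.eval (((n + 1 : ℕ) : ℂ)) with hlam
  have hB := TopologicalSpace.isBasis_countableBasis Hc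
  have hcover : ∀ V ∈ TopologicalSpace.countableBasis Hc, ∃ 𝒦 : Set (Set ℂ), 𝒦.Countable ∧
      (∀ K ∈ 𝒦, IsCompact K ∧ (0 : ℂ) ∉ K ∧ Dense (translatesMeet lam K V)) ∧
        {a : ℂ | a ≠ 0} ⊆ ⋃₀ 𝒦 := by
    intro V hV
    have hex : ∀ a : {a : ℂ // a ≠ 0}, ∃ K ∈ 𝓝 (a : ℂ), IsCompact K ∧ (0 : ℂ) ∉ K ∧
        Dense (translatesMeet lam K V) := fun a =>
      exists_nhds_dense_translatesMeet hdeg (hB.isOpen hV)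
        (TopologicalSpace.nonempty_of_mem_countableBasis hV) a.2
    choose K hKnhds hK using hex
    obtain ⟨T, hTc, hT⟩ := TopologicalSpace.countable_cover_nhds
      (f := fun a : {a : ℂ // a ≠ 0} => Subtype.val ⁻¹' K a)
      (fun a => continuous_subtype_val.continuousAt.preimage_mem_nhds (hKnhds a))
    refine ⟨K '' T, hTc.image K, ?_, fun a ha => ?_⟩
    · rintro _ ⟨a, -, rfl⟩
      exact hK a
    · have : (⟨a, ha⟩ : {a : ℂ // a ≠ 0}) ∈ ⋃ x ∈ T, Subtype.val ⁻¹' K x := hT ▸ mem_univ _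
      obtain ⟨x, hx, hax⟩ := mem_iUnion₂.mp this
      exact ⟨K x, mem_image_of_mem K hx, hax⟩
  choose! 𝒦 h𝒦c h𝒦 h𝒦cover using hcover
  refine ⟨⋃ V ∈ TopologicalSpace.countableBasis Hc, (fun K => translatesMeet lam K V) '' 𝒦 V,
    (TopologicalSpace.countable_countableBasis Hc).biUnion fun V hV => (h𝒦c V hV).image _,
    ?_, ?_⟩
  · intro E hE
    obtain ⟨V, hV, K, hK, rfl⟩ := mem_iUnion₂.mp hE
    obtain ⟨hKc, -, hd⟩ := h𝒦 V hV K hK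
    exact ⟨isOpen_translatesMeet lam hKc (hB.isOpen hV), hd⟩
  · ext f
    rw [mem_iInter₂, mem_sInter]
    constructor
    · intro hf E hE
      obtain ⟨V, hV, K, hK, rfl⟩ := mem_iUnion₂.mp hE
      intro a ha
      have ha0 : a ≠ 0 := fun h => (h𝒦 V hV K hK).2.1 (h ▸ ha)
      obtain ⟨_, hV', n, rfl⟩ := (hf a ha0).inter_open_nonempty V (hB.isOpen hV)
        (TopologicalSpace.nonempty_of_mem_countableBasis hV)
      exact ⟨n, hV'⟩
    · intro hf a ha
      refine hB.dense_iff.mpr fun V hV _ => ?_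
      obtain ⟨K, hK, haK⟩ := h𝒦cover V hV ha
      obtain ⟨n, hn⟩ := hf _ (mem_iUnion₂.mpr ⟨V, hV, K, hK, rfl⟩) a haK
      exact ⟨_, hn, n, rfl⟩

theorem common_hypercyclic_polynomial_sequence
    (p : Polynomial ℂ) (hdeg : 0 < p.natDegree)
    (hne : ∀ n : ℕ, p.eval (((n + 1 : ℕ) : ℂ)) ≠ 0) :
    IsGδ (⋂ a ∈ {a : ℂ | a ≠ 0}, HC (fun n : ℕ => p.eval (((n + 1 : ℕ) : ℂ))) a) ∧
    Dense (⋂ a ∈ {a : ℂ | a ≠ 0}, HC (fun n : ℕ => p.eval (((n + 1 : ℕ) : ℂ))) a) ∧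
    (⋂ a ∈ {a : ℂ | a ≠ 0}, HC (fun n : ℕ => p.eval (((n + 1 : ℕ) : ℂ))) a).Nonempty := by
  obtain ⟨𝒮, hc, h𝒮, heq⟩ := exists_countable_iInter_HC_eq hdeg
  have : Nonempty Hc := ⟨⟨0, differentiable_const 0⟩⟩
  have hdense : Dense (⋂₀ 𝒮) :=
    dense_sInter_of_isOpen (fun E hE => (h𝒮 E hE).1) hc fun E hE => (h𝒮 E hE).2
  rw [heq]
  exact ⟨⟨𝒮, fun E hE => (h𝒮 E hE).1, hc, rfl⟩, hdense, hdense.nonempty⟩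
end
end
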